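/- arXiv:1208.6228 — 7 statements merged into one kernel-verified Lean document; each statement's English description precedes it below -/
import Mathlib

section
/- Let M(s) = {(p,φ) ∈ ℝ × [0,π) : ℓ(p,φ) ∩ T ≠ ∅ and H¹(ℓ(p,φ) ∩ T) ≤ s}, and let μ(M(s)) denote its two-dimensional Lebesgue measure. Then μ(M(s)) = 0 if s < 0; μ(M(s)) = H₁(s) if 0 ≤ s < h; μ(M(s)) = H₂(s) if h ≤ s < a; μ(M(s)) = H₃(s) if a ≤ s < b; μ(M(s)) = H₄(s) if b ≤ s < c; and μ(M(s)) = u if s ≥ c. (Equivalently, the chord length distribution function of T is F(s) = μ(M(s))/u.) -/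
open Real MeasureTheory

namespace RightTriangleChord

/-! ### Parameters of chords -/

/-- The chord cut out of the triangle with vertices `(0,0)`, `(a,0)`, `(0,b)` by the line at signed
distance `p` with direction angle `φ`, described by the arc length parameter on that line. -/
def chordParams (a b p φ : ℝ) : Set ℝ :=
  {t | 0 ≤ -p * sin φ + t * cos φ ∧ 0 ≤ p * cos φ + t * sin φ ∧
    b * (-p * sin φ + t * cos φ) + a * (p * cos φ + t * sin φ) ≤ a * b}

/-- The arc length parametrization of a line. -/
noncomputable def lineParam (p φ t : ℝ) : EuclideanSpace ℝ (Fin 2) :=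
  !₂[-p * sin φ + t * cos φ, p * cos φ + t * sin φ]

lemma isometry_lineParam (p φ : ℝ) : Isometry (lineParam p φ) := by
  refine Isometry.of_dist_eq fun t t' => ?_
  have h : (t * cos φ - t' * cos φ) ^ 2 + (t * sin φ - t' * sin φ) ^ 2 = (t - t') ^ 2 := by
    linear_combination (t - t') ^ 2 * sin_sq_add_cos_sq φ
  simp [lineParam, EuclideanSpace.dist_eq, Real.dist_eq, h, Real.sqrt_sq_eq_abs]

lemma line_inter_triangle_eq_image (a b p φ : ℝ) :
    {P : EuclideanSpace ℝ (Fin 2) | -(P 0) * sin φ + P 1 * cos φ = p} ∩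
      {P | 0 ≤ P 0 ∧ 0 ≤ P 1 ∧ b * P 0 + a * P 1 ≤ a * b} =
      lineParam p φ '' chordParams a b p φ := by
  have h := sin_sq_add_cos_sq φ
  ext P
  constructor
  · rintro ⟨hp, hP⟩
    have hp : -(P 0) * sin φ + P 1 * cos φ = p := hp
    have h0 : -p * sin φ + (P 0 * cos φ + P 1 * sin φ) * cos φ = P 0 := by
      rw [← hp]; linear_combination P 0 * h
    have h1 : p * cos φ + (P 0 * cos φ + P 1 * sin φ) * sin φ = P 1 := by
      rw [← hp]; linear_combination P 1 * h
    refine ⟨P 0 * cos φ + P 1 * sin φ, ?_, ?_⟩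
    · simpa only [chordParams, Set.mem_ofPred_eq, h0, h1] using hP
    · ext i
      fin_cases i
      · simpa [lineParam] using h0
      · simpa [lineParam] using h1
  · rintro ⟨t, ht, rfl⟩
    refine ⟨?_, by simpa [lineParam, chordParams] using ht⟩
    simp only [lineParam, Set.mem_ofPred_eq, Matrix.cons_val_zero,
      Matrix.cons_val_one]
    linear_combination p * h

lemma hausdorffMeasure_lineParam_image (p φ : ℝ) (C : Set ℝ) :
    μH[1] (lineParam p φ '' C) = volume C := by
  rw [(isometry_lineParam p φ).hausdorffMeasure_image (Or.inl zero_le_one), hausdorffMeasure_real]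

/-! ### The offsets with short chords, for a fixed direction -/

/-- Sublevel sets of a tent function of height `m` that rises over length `d₁` and falls over
length `d₂`. -/
lemma volume_tent_sublevel {p₁ d₁ d₂ m s : ℝ} (hd₁ : 0 < d₁) (hd₂ : 0 < d₂) (hm : 0 < m)
    (hs : 0 ≤ s) :
    volume {p : ℝ | 0 ≤ min (m * (p - p₁) / d₁) (m * (p₁ + d₁ + d₂ - p) / d₂) ∧
      min (m * (p - p₁) / d₁) (m * (p₁ + d₁ + d₂ - p) / d₂) ≤ s} =
      ENNReal.ofReal ((d₁ + d₂) * min 1 (s / m)) := by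
  have key : ∀ p, 0 ≤ min (m * (p - p₁) / d₁) (m * (p₁ + d₁ + d₂ - p) / d₂) ↔
      p₁ ≤ p ∧ p ≤ p₁ + d₁ + d₂ := by
    intro p
    rw [le_min_iff, le_div_iff₀ hd₁, le_div_iff₀ hd₂, zero_mul, zero_mul,
      mul_nonneg_iff_of_pos_left hm, mul_nonneg_iff_of_pos_left hm, sub_nonneg, sub_nonneg]
  have key₂ : ∀ p, min (m * (p - p₁) / d₁) (m * (p₁ + d₁ + d₂ - p) / d₂) ≤ s ↔
      p ≤ p₁ + s / m * d₁ ∨ p₁ + d₁ + d₂ - s / m * d₂ ≤ p := by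
    intro p
    rw [min_le_iff]
    refine or_congr ?_ ?_
    · rw [div_le_iff₀ hd₁, ← le_div_iff₀' hm, sub_le_iff_le_add', mul_div_right_comm]
    · rw [div_le_iff₀ hd₂, ← le_div_iff₀' hm, sub_le_comm, mul_div_right_comm]
  simp only [key, key₂]
  have hq : 0 ≤ s / m := by positivity
  generalize s / m = q at hq
  rcases le_total 1 q with h | h
  · have : {p : ℝ | (p₁ ≤ p ∧ p ≤ p₁ + d₁ + d₂) ∧
        (p ≤ p₁ + q * d₁ ∨ p₁ + d₁ + d₂ - q * d₂ ≤ p)} = Set.Icc p₁ (p₁ + d₁ + d₂) := by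
      ext p
      refine ⟨fun hp => hp.1, fun hp => ⟨hp, ?_⟩⟩
      by_contra! hcon
      nlinarith [hcon.1, hcon.2]
    rw [this, Real.volume_Icc, min_eq_left h]
    congr 1
    ring
  · have h₁ : q * d₁ ≤ d₁ := by nlinarith
    have h₂ : q * d₂ ≤ d₂ := by nlinarith
    have h₁' : 0 ≤ q * d₁ := by positivity
    have h₂' : 0 ≤ q * d₂ := by positivity
    have : {p : ℝ | (p₁ ≤ p ∧ p ≤ p₁ + d₁ + d₂) ∧
        (p ≤ p₁ + q * d₁ ∨ p₁ + d₁ + d₂ - q * d₂ ≤ p)} =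
        Set.Icc p₁ (p₁ + q * d₁) ∪ Set.Icc (p₁ + d₁ + d₂ - q * d₂) (p₁ + d₁ + d₂) := by
      ext p
      simp only [Set.mem_ofPred_eq, Set.mem_union, Set.mem_Icc]
      constructor
      · rintro ⟨⟨_, _⟩, h | h⟩
        · exact Or.inl ⟨by linarith, by linarith⟩
        · exact Or.inr ⟨by linarith, by linarith⟩
      · rintro (⟨_, _⟩ | ⟨_, _⟩)
        · exact ⟨⟨by linarith, by linarith⟩, Or.inl (by linarith)⟩
        · exact ⟨⟨by linarith, by linarith⟩, Or.inr (by linarith)⟩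
    have hdisj : AEDisjoint volume (Set.Icc p₁ (p₁ + q * d₁))
        (Set.Icc (p₁ + d₁ + d₂ - q * d₂) (p₁ + d₁ + d₂)) := by
      refine measure_mono_null (t := {p₁ + d₁}) ?_ (by simp)
      rintro p ⟨⟨_, hp⟩, ⟨hp', _⟩⟩
      exact le_antisymm (by linarith) (by linarith)
    rw [this, measure_union₀ measurableSet_Icc.nullMeasurableSet hdisj, Real.volume_Icc,
      Real.volume_Icc, ← ENNReal.ofReal_add (by linarith) (by linarith), min_eq_right h]
    congr 1
    ring

lemma volume_short_chords_of_tent {C : ℝ → Set ℝ} {lo hi : ℝ → ℝ} {p₁ d₁ d₂ m s : ℝ}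
    (hC : ∀ p, C p = Set.Icc (lo p) (hi p))
    (hlen : ∀ p, hi p - lo p = min (m * (p - p₁) / d₁) (m * (p₁ + d₁ + d₂ - p) / d₂))
    (hd₁ : 0 < d₁) (hd₂ : 0 < d₂) (hm : 0 < m) (hs : 0 ≤ s) :
    volume {p | (C p).Nonempty ∧ volume (C p) ≤ ENNReal.ofReal s} =
      ENNReal.ofReal ((d₁ + d₂) * min 1 (s / m)) := by
  rw [← volume_tent_sublevel (p₁ := p₁) hd₁ hd₂ hm hs]
  congr 1
  ext p
  simp only [Set.mem_ofPred_eq, hC, Set.nonempty_Icc, Real.volume_Icc,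
    ENNReal.ofReal_le_ofReal_iff hs, ← hlen, sub_nonneg]

/-- The width of the triangle orthogonally to the direction `φ ∈ [0, π]`. -/
noncomputable def width (a b φ : ℝ) : ℝ :=
  max (b * cos φ + a * sin φ) (max (a * sin φ) (-(b * cos φ)))

/-- The measure of the offsets with chord length at most `s`, in a direction of width `w`. -/
noncomputable def shortMeasure (a b s w : ℝ) : ℝ := w * min 1 (s * w / (a * b))

lemma volume_short_chords_of_cos_pos {a b s φ : ℝ} (ha : 0 < a) (hb : 0 < b) (hs : 0 ≤ s)
    (hcos : 0 < cos φ) (hsin : 0 < sin φ) :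
    volume {p | (chordParams a b p φ).Nonempty ∧
      volume (chordParams a b p φ) ≤ ENNReal.ofReal s} =
      ENNReal.ofReal (shortMeasure a b s (width a b φ)) := by
  have hcs := sin_sq_add_cos_sq φ
  have hw : width a b φ = b * cos φ + a * sin φ := by
    rw [width, max_eq_left]
    have := mul_pos ha hsin
    have := mul_pos hb hcos
    exact max_le (by linarith) (by linarith)
  have hW : 0 < b * cos φ + a * sin φ := by positivity
  rw [hw, shortMeasure]
  convert volume_short_chords_of_tent (p₁ := -(a * sin φ)) (d₁ := a * sin φ) (d₂ := b * cos φ)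
    (m := a * b / (b * cos φ + a * sin φ))
    (lo := fun p => max (-p * cos φ / sin φ) (p * sin φ / cos φ))
    (hi := fun p => (a * b - p * (a * cos φ - b * sin φ)) / (b * cos φ + a * sin φ))
    ?_ ?_ (by positivity) (by positivity) (by positivity) hs using 3
  · ring
  · congr 1
    field_simp
  · intro p
    ext t
    simp only [chordParams, Set.mem_ofPred_eq, Set.mem_Icc, max_le_iff, div_le_iff₀ hcos,
      div_le_iff₀ hsin, le_div_iff₀ hW]
    constructor
    · rintro ⟨h₁, h₂, h₃⟩
      exact ⟨⟨by linarith, by linarith⟩, by linarith⟩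
    · rintro ⟨⟨h₁, h₂⟩, h₃⟩
      exact ⟨by linarith, by linarith, by linarith⟩
  · intro p
    simp only [← min_sub_sub_left]
    congr 1
    · field_simp
      linear_combination (b * p) * hcs
    · field_simp
      linear_combination (-a * p) * hcs

lemma volume_short_chords_of_cos_neg_of_pos {a b s φ : ℝ} (hb : 0 < b)
    (hs : 0 ≤ s) (hcos : cos φ < 0) (hsin : 0 < sin φ) (hW : 0 < b * cos φ + a * sin φ) :
    volume {p | (chordParams a b p φ).Nonempty ∧
      volume (chordParams a b p φ) ≤ ENNReal.ofReal s} =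
      ENNReal.ofReal (shortMeasure a b s (width a b φ)) := by
  have hcs := sin_sq_add_cos_sq φ
  have hbc := mul_neg_of_pos_of_neg hb hcos
  have hw : width a b φ = a * sin φ := by
    rw [width, max_eq_left (a := a * sin φ), max_eq_right] <;> linarith
  have hnc : 0 < -cos φ := by linarith
  have hcos' := hcos.ne
  have ha : 0 < a := pos_of_mul_pos_left (b := sin φ) (by linarith) hsin.le
  rw [hw, shortMeasure]
  convert volume_short_chords_of_tent (p₁ := -(a * sin φ)) (d₁ := b * cos φ + a * sin φ)
    (d₂ := -(b * cos φ)) (m := b / sin φ)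
    (lo := fun p => -p * cos φ / sin φ)
    (hi := fun p => min ((a * b - p * (a * cos φ - b * sin φ)) / (b * cos φ + a * sin φ))
      (-p * sin φ / -cos φ))
    ?_ ?_ hW (by linarith) (by positivity) hs using 3
  · ring
  · congr 1
    field_simp
  · intro p
    ext t
    simp only [chordParams, Set.mem_ofPred_eq, Set.mem_Icc, le_min_iff, le_div_iff₀ hnc,
      div_le_iff₀ hsin, le_div_iff₀ hW]
    constructor
    · rintro ⟨h₁, h₂, h₃⟩
      exact ⟨by linarith, by linarith, by linarith⟩
    · rintro ⟨h₂, h₃, h₁⟩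
      exact ⟨by linarith, by linarith, by linarith⟩
  · intro p
    simp only [← min_sub_sub_right]
    congr 1
    · field_simp
      linear_combination (b * p) * hcs
    · field_simp
      linear_combination (p) * hcs

lemma volume_short_chords_of_cos_neg_of_neg {a b s φ : ℝ} (ha : 0 < a) (hb : 0 < b)
    (hs : 0 ≤ s) (hcos : cos φ < 0) (hsin : 0 < sin φ) (hW : b * cos φ + a * sin φ < 0) :
    volume {p | (chordParams a b p φ).Nonempty ∧
      volume (chordParams a b p φ) ≤ ENNReal.ofReal s} =
      ENNReal.ofReal (shortMeasure a b s (width a b φ)) := by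
  have hcs := sin_sq_add_cos_sq φ
  have hbc := mul_neg_of_pos_of_neg hb hcos
  have has := mul_pos ha hsin
  have hw : width a b φ = -(b * cos φ) := by
    rw [width, max_eq_right (b := -(b * cos φ)), max_eq_right] <;> linarith
  have hnc : 0 < -cos φ := by linarith
  have hcos' := hcos.ne
  have hW' := hW.ne
  have hnW : 0 < -(b * cos φ + a * sin φ) := by linarith
  rw [hw, shortMeasure]
  convert volume_short_chords_of_tent (p₁ := b * cos φ) (d₁ := -(b * cos φ + a * sin φ))
    (d₂ := a * sin φ) (m := a / -cos φ)
    (lo := fun p => max (-(a * b - p * (a * cos φ - b * sin φ)) / -(b * cos φ + a * sin φ))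
      (-p * cos φ / sin φ))
    (hi := fun p => (-p * sin φ / -cos φ))
    ?_ ?_ hnW has (by positivity) hs using 3
  · ring
  · congr 1
    field_simp
  · intro p
    ext t
    simp only [chordParams, Set.mem_ofPred_eq, Set.mem_Icc, max_le_iff, le_div_iff₀ hnc,
      div_le_iff₀ hsin, div_le_iff₀ hnW]
    constructor
    · rintro ⟨h₁, h₂, h₃⟩
      exact ⟨⟨by linarith, by linarith⟩, by linarith⟩
    · rintro ⟨⟨h₂, h₃⟩, h₁⟩
      exact ⟨by linarith, by linarith, by linarith⟩
  · intro p
    simp only [← min_sub_sub_left]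
    congr 1
    · rw [neg_div_neg_eq, div_sub_div _ _ hnc.ne' hW', div_mul_eq_mul_div, div_div,
        div_eq_div_iff (mul_ne_zero hnc.ne' hW') (mul_ne_zero hnc.ne' hnW.ne')]
      linear_combination (-(a * p * cos φ) * (b * cos φ + a * sin φ)) * hcs
    · field_simp
      linear_combination (p) * hcs

lemma ae_volume_short_chords {a b s : ℝ} (ha : 0 < a) (hb : 0 < b) (hs : 0 ≤ s) :
    ∀ᵐ φ : ℝ, φ ∈ Set.Ico 0 π →
      volume {p | (chordParams a b p φ).Nonempty ∧
        volume (chordParams a b p φ) ≤ ENNReal.ofReal s} =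
      ENNReal.ofReal (shortMeasure a b s (width a b φ)) := by
  have hα₀ := arctan_pos.2 (div_pos ha hb)
  have hα₁ := arctan_lt_pi_div_two (a / b)
  have hsa : sin (arctan (a / b)) = a / b * cos (arctan (a / b)) := by
    rw [← tan_mul_cos (cos_arctan_pos _).ne', tan_arctan]
  have hca := cos_arctan_pos (a / b)
  have hW : ∀ φ, (b * cos φ + a * sin φ) * cos (arctan (a / b)) =
      b * cos (φ - arctan (a / b)) := by
    intro φ
    rw [cos_sub, hsa]
    field_simp
  filter_upwards [Measure.ae_ne volume 0, Measure.ae_ne volume (π / 2),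
    Measure.ae_ne volume (π / 2 + arctan (a / b))] with φ h₀ h₁ h₂ hφ
  have hφ₀ : 0 < φ := lt_of_le_of_ne hφ.1 h₀.symm
  have hsin := sin_pos_of_pos_of_lt_pi hφ₀ hφ.2
  rcases lt_or_gt_of_ne h₁ with h | h
  · exact volume_short_chords_of_cos_pos ha hb hs (cos_pos_of_mem_Ioo ⟨by linarith, h⟩) hsin
  have hcos : cos φ < 0 := cos_neg_of_pi_div_two_lt_of_lt h (by linarith [hφ.2])
  rcases lt_or_gt_of_ne h₂ with h' | h'
  · refine volume_short_chords_of_cos_neg_of_pos hb hs hcos hsin ?_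
    have := cos_pos_of_mem_Ioo (x := φ - arctan (a / b)) ⟨by linarith, by linarith⟩
    refine pos_of_mul_pos_left (b := cos (arctan (a / b))) ?_ hca.le
    rw [hW]
    positivity
  · refine volume_short_chords_of_cos_neg_of_neg ha hb hs hcos hsin ?_
    have := cos_neg_of_pi_div_two_lt_of_lt (x := φ - arctan (a / b)) (by linarith)
      (by linarith [hφ.2])
    refine neg_of_mul_neg_left (b := cos (arctan (a / b))) ?_ hca.le
    rw [hW]
    exact mul_neg_of_pos_of_neg hb this

/-! ### Integration over the offsets -/

/-- The set of lines that meet the triangle in a chord of length at most `s`. -/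
def shortLines (a b s : ℝ) : Set (ℝ × ℝ) :=
  {q | q.2 ∈ Set.Ico 0 π ∧ (chordParams a b q.1 q.2).Nonempty ∧
    volume (chordParams a b q.1 q.2) ≤ ENNReal.ofReal s}

lemma shortLines_max_zero (a b s : ℝ) : shortLines a b (max s 0) = shortLines a b s := by
  simp [shortLines, ENNReal.ofReal_max]

lemma measurable_volume_chordParams (a b : ℝ) :
    Measurable fun q : ℝ × ℝ => volume (chordParams a b q.1 q.2) := by
  have : IsClosed {r : (ℝ × ℝ) × ℝ | r.2 ∈ chordParams a b r.1.1 r.1.2} := by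
    simp only [chordParams, Set.ofPred_and]
    refine IsClosed.inter (isClosed_le (by fun_prop) (by fun_prop)) (IsClosed.inter
      (isClosed_le (by fun_prop) (by fun_prop)) (isClosed_le (by fun_prop) (by fun_prop)))
  exact measurable_measure_prodMk_left this.measurableSet

lemma measurableSet_chordParams_nonempty {a b : ℝ} (ha : 0 < a) (hb : 0 < b) :
    MeasurableSet {q : ℝ × ℝ | q.2 ∈ Set.Ico 0 π ∧ (chordParams a b q.1 q.2).Nonempty} := by
  have hK : IsCompact {P : ℝ × ℝ | 0 ≤ P.1 ∧ 0 ≤ P.2 ∧ b * P.1 + a * P.2 ≤ a * b} := by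
    refine (isCompact_Icc (a := ((0, 0) : ℝ × ℝ)) (b := (a, b))).of_isClosed_subset ?_ ?_
    · simp only [Set.ofPred_and]
      exact IsClosed.inter (isClosed_le (by fun_prop) (by fun_prop)) (IsClosed.inter
        (isClosed_le (by fun_prop) (by fun_prop)) (isClosed_le (by fun_prop) (by fun_prop)))
    · rintro ⟨x, y⟩ ⟨hx, hy, hxy⟩
      simp only at hx hy hxy
      exact ⟨⟨hx, hy⟩, ⟨by simp only; nlinarith, by simp only; nlinarith⟩⟩
  have hcont : Continuous fun r : (ℝ × ℝ) × ℝ =>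
      (-r.1.1 * sin r.2 + r.1.2 * cos r.2, r.2) := by fun_prop
  have himage := ((hK.prod (isCompact_Icc (a := (0 : ℝ)) (b := π))).image hcont).measurableSet
  have : {q : ℝ × ℝ | q.2 ∈ Set.Ico 0 π ∧ (chordParams a b q.1 q.2).Nonempty} =
      (fun r : (ℝ × ℝ) × ℝ => (-r.1.1 * sin r.2 + r.1.2 * cos r.2, r.2)) ''
        ({P : ℝ × ℝ | 0 ≤ P.1 ∧ 0 ≤ P.2 ∧ b * P.1 + a * P.2 ≤ a * b} ×ˢ Set.Icc 0 π) ∩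
      Prod.snd ⁻¹' Set.Ico 0 π := by
    ext ⟨p, φ⟩
    have h := sin_sq_add_cos_sq φ
    constructor
    · rintro ⟨hφ, t, ht⟩
      refine ⟨⟨((-p * sin φ + t * cos φ, p * cos φ + t * sin φ), φ),
        ⟨ht, Set.Ico_subset_Icc_self hφ⟩, Prod.ext ?_ rfl⟩, hφ⟩
      simp only
      linear_combination p * h
    · rintro ⟨⟨⟨⟨x, y⟩, ψ⟩, ⟨hP, -⟩, hr⟩, hφ⟩
      simp only [Prod.mk.injEq] at hr
      obtain ⟨hp, rfl⟩ := hr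
      refine ⟨hφ, x * cos ψ + y * sin ψ, ?_⟩
      have h0 : -p * sin ψ + (x * cos ψ + y * sin ψ) * cos ψ = x := by
        rw [← hp]; linear_combination x * h
      have h1 : p * cos ψ + (x * cos ψ + y * sin ψ) * sin ψ = y := by
        rw [← hp]; linear_combination y * h
      simpa only [chordParams, Set.mem_ofPred_eq, h0, h1] using hP
  rw [this]
  exact himage.inter (measurable_snd measurableSet_Ico)

lemma measurableSet_shortLines {a b : ℝ} (ha : 0 < a) (hb : 0 < b) (s : ℝ) :
    MeasurableSet (shortLines a b s) := by
  have : shortLines a b s =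
      {q : ℝ × ℝ | q.2 ∈ Set.Ico 0 π ∧ (chordParams a b q.1 q.2).Nonempty} ∩
        {q | volume (chordParams a b q.1 q.2) ≤ ENNReal.ofReal s} := by
    ext q
    simp only [shortLines, Set.mem_ofPred_eq, Set.mem_inter_iff, and_assoc]
  rw [this]
  exact (measurableSet_chordParams_nonempty ha hb).inter
    (measurableSet_le (measurable_volume_chordParams a b) measurable_const)

lemma width_nonneg_of_mem_Ico {a b φ : ℝ} (ha : 0 < a) (hφ : φ ∈ Set.Ico 0 π) :
    0 ≤ width a b φ :=
  (mul_nonneg ha.le (sin_nonneg_of_nonneg_of_le_pi hφ.1 hφ.2.le)).trans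
    ((le_max_left _ _).trans (le_max_right _ _))

lemma shortMeasure_nonneg {a b s w : ℝ} (ha : 0 < a) (hb : 0 < b) (hs : 0 ≤ s) (hw : 0 ≤ w) :
    0 ≤ shortMeasure a b s w :=
  mul_nonneg hw (le_min zero_le_one (by positivity))

lemma continuous_width (a b : ℝ) : Continuous (width a b) := by
  unfold width
  fun_prop

lemma continuous_shortMeasure (a b s : ℝ) : Continuous (shortMeasure a b s) := by
  unfold shortMeasure
  fun_prop

lemma volume_shortLines {a b s : ℝ} (ha : 0 < a) (hb : 0 < b) (hs : 0 ≤ s) :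
    volume (shortLines a b s) =
      ENNReal.ofReal (∫ φ in 0..π, shortMeasure a b s (width a b φ)) := by
  have hcont : Continuous fun φ => shortMeasure a b s (width a b φ) :=
    (continuous_shortMeasure a b s).comp (continuous_width a b)
  rw [Measure.volume_eq_prod, Measure.prod_apply_symm (measurableSet_shortLines ha hb s),
    intervalIntegral.integral_of_le pi_pos.le, ← integral_Ico_eq_integral_Ioc,
    ofReal_integral_eq_lintegral_ofReal
      (hcont.integrableOn_Icc.mono_set Set.Ico_subset_Icc_self)
      ((ae_restrict_iff' measurableSet_Ico).2 (ae_of_all _ fun φ hφ =>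
        shortMeasure_nonneg ha hb hs (width_nonneg_of_mem_Ico ha hφ))),
    ← lintegral_indicator measurableSet_Ico]
  refine lintegral_congr_ae ?_
  filter_upwards [ae_volume_short_chords ha hb hs] with φ hφ
  by_cases h : φ ∈ Set.Ico 0 π
  · rw [Set.indicator_of_mem h, ← hφ h]
    congr 1
    ext p
    simp [shortLines, h.1, h.2]
  · rw [Set.indicator_of_notMem h]
    convert measure_empty (μ := (volume : Measure ℝ))
    ext p
    simp only [shortLines, Set.mem_preimage, Set.mem_ofPred_eq, h, false_and,
      Set.mem_empty_iff_false]

/-! ### Integration over the directions -/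

/-- The contribution of the directions on which the width is `k * cos t` for `t ∈ [0, x]`. -/
noncomputable def sectorIntegral (a b s k x : ℝ) : ℝ :=
  ∫ t in 0..x, shortMeasure a b s (k * cos t)

lemma intervalIntegrable_shortMeasure_mul_cos (a b s k x y : ℝ) :
    IntervalIntegrable (fun t => shortMeasure a b s (k * cos t)) volume x y :=
  ((continuous_shortMeasure a b s).comp
    (continuous_const.mul continuous_cos)).intervalIntegrable _ _

lemma shortMeasure_of_le {a b s k r w : ℝ} (hr : 0 < r) (hkr : k * r = a * b) (hk : 0 < k)
    (hw : s * w ≤ r) : shortMeasure a b s (k * w) = k * s / r * w ^ 2 := by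
  rw [shortMeasure, ← hkr, min_eq_right]
  · field_simp
  · rw [div_le_one (by positivity)]
    nlinarith

lemma shortMeasure_of_ge {a b s k r w : ℝ} (hr : 0 < r) (hkr : k * r = a * b) (hk : 0 < k)
    (hw : r ≤ s * w) : shortMeasure a b s (k * w) = k * w := by
  rw [shortMeasure, ← hkr, min_eq_left, mul_one]
  rw [one_le_div (by positivity)]
  nlinarith

lemma sectorIntegral_of_le {a b s k r x : ℝ} (hr : 0 < r) (hkr : k * r = a * b) (hk : 0 < k)
    (hs : 0 ≤ s) (hsr : s ≤ r) :
    sectorIntegral a b s k x = k / (2 * r) * s * (x + sin x * cos x) := by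
  have : ∀ t, shortMeasure a b s (k * cos t) = k * s / r * cos t ^ 2 := fun t =>
    shortMeasure_of_le hr hkr hk ((mul_le_of_le_one_right hs (cos_le_one t)).trans hsr)
  simp only [sectorIntegral, this, intervalIntegral.integral_const_mul, integral_cos_sq]
  simp only [sin_zero, cos_zero]
  field_simp
  ring

lemma sectorIntegral_of_le_mul_cos {a b s k r x : ℝ} (hr : 0 < r) (hkr : k * r = a * b)
    (hk : 0 < k) (hs : 0 ≤ s) (hx₀ : 0 ≤ x) (hx : x ≤ π / 2) (hsx : r ≤ s * cos x) :
    sectorIntegral a b s k x = k * sin x := by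
  have : sectorIntegral a b s k x = ∫ t in 0..x, k * cos t := by
    refine intervalIntegral.integral_congr fun t ht => ?_
    rw [Set.uIcc_of_le hx₀] at ht
    exact shortMeasure_of_ge hr hkr hk (hsx.trans (mul_le_mul_of_nonneg_left
      (cos_le_cos_of_nonneg_of_le_pi ht.1 (by linarith [pi_pos]) ht.2) hs))
  rw [this, intervalIntegral.integral_const_mul, integral_cos, sin_zero, sub_zero]

lemma sectorIntegral_of_mul_cos_le {a b s k r x : ℝ} (hr : 0 < r) (hkr : k * r = a * b)
    (hk : 0 < k) (hsr : r ≤ s) (hx₀ : 0 ≤ x) (hx : x ≤ π / 2) (hsx : s * cos x ≤ r) :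
    sectorIntegral a b s k x = k / 2 * √(1 - (r / s) ^ 2) + k / (2 * r) * (s * arcsin (r / s)) +
      k / (2 * r) * s * (x + sin x * cos x - π / 2) := by
  have hs : 0 < s := hr.trans_le hsr
  have hrs : r / s ≤ 1 := (div_le_one hs).2 hsr
  have hrs₀ : 0 < r / s := by positivity
  have hcos : cos (arccos (r / s)) = r / s := cos_arccos (by linarith) hrs
  have hθ : arccos (r / s) ≤ x := by
    rw [← arccos_cos hx₀ (by linarith [pi_pos])]
    exact arccos_le_arccos (by rwa [le_div_iff₀' hs])
  have h₁ := sectorIntegral_of_le_mul_cos (a := a) (b := b) hr hkr hk hs.le (arccos_nonneg (r / s))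
    (hθ.trans hx) (by rw [hcos, mul_div_cancel₀ _ hs.ne'])
  have h₂ : (∫ t in (arccos (r / s))..x, shortMeasure a b s (k * cos t)) =
      ∫ t in (arccos (r / s))..x, k * s / r * cos t ^ 2 := by
    refine intervalIntegral.integral_congr fun t ht => ?_
    rw [Set.uIcc_of_le hθ] at ht
    have := cos_le_cos_of_nonneg_of_le_pi (arccos_nonneg _) (by linarith [pi_pos, ht.2]) ht.1
    rw [hcos, le_div_iff₀' hs] at this
    exact shortMeasure_of_le hr hkr hk this
  rw [sectorIntegral] at h₁
  rw [sectorIntegral, ← intervalIntegral.integral_add_adjacent_intervals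
    (intervalIntegrable_shortMeasure_mul_cos a b s k 0 (arccos (r / s)))
    (intervalIntegrable_shortMeasure_mul_cos a b s k (arccos (r / s)) x), h₁, h₂,
    intervalIntegral.integral_const_mul, integral_cos_sq, hcos, sin_arccos,
    arccos_eq_pi_div_two_sub_arcsin]
  field_simp
  ring

lemma mul_le_iff_of_proportion {d c x k r s : ℝ} (hd : d = c * x) (hc : 0 < c) (hd₀ : 0 < d)
    (hk : c * k = d * r) : s * x ≤ k ↔ s ≤ r := by
  rw [← mul_le_mul_iff_right₀ hc, hk, mul_left_comm, ← hd, mul_comm s d, mul_le_mul_iff_right₀ hd₀]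

lemma le_mul_iff_of_proportion {d c x k r s : ℝ} (hd : d = c * x) (hc : 0 < c) (hd₀ : 0 < d)
    (hk : c * k = d * r) : k ≤ s * x ↔ r ≤ s := by
  rw [← mul_le_mul_iff_right₀ hc, hk, mul_left_comm, ← hd, mul_comm s d, mul_le_mul_iff_right₀ hd₀]

section Hypotenuse

variable {a b c α : ℝ}

lemma add_div_mul_sin_mul_cos (hb : b = c * cos α) (ha : a = c * sin α) (hb₀ : 0 < b)
    (ha₀ : 0 < a) : (a / b + b / a) * (sin α * cos α) = 1 := by
  have hab : a * cos α = b * sin α := by rw [ha, hb]; ring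
  have h : sin α * cos α * (a * a + b * b) = a * b := by
    linear_combination (a * sin α - b * cos α) * hab + a * b * sin_sq_add_cos_sq α
  rw [div_add_div _ _ hb₀.ne' ha₀.ne', div_mul_eq_mul_div, div_eq_one_iff_eq (by positivity)]
  linear_combination h

lemma hypotenuse_div_two_mul_altitude {h : ℝ} (hb : b = c * cos α) (ha : a = c * sin α)
    (hc : 0 < c) (hb₀ : 0 < b) (ha₀ : 0 < a) (hh : c * h = a * b) :
    c / (2 * h) = (a / b + b / a) / 2 := by
  have hh₀ : 0 < h := pos_of_mul_pos_right (hh ▸ mul_pos ha₀ hb₀) hc.le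
  have hc₂ : a ^ 2 + b ^ 2 = c ^ 2 := by
    rw [ha, hb]
    linear_combination c ^ 2 * sin_sq_add_cos_sq α
  field_simp
  linear_combination (-c) * hh - h * hc₂

lemma width_eq_of_le_pi_div_two {φ : ℝ} (hb : b = c * cos α) (ha : a = c * sin α) (hb₀ : 0 < b)
    (ha₀ : 0 < a) (hφ₀ : 0 ≤ φ) (hφ : φ ≤ π / 2) : width a b φ = c * cos (φ - α) := by
  have h₁ := mul_nonneg ha₀.le (sin_nonneg_of_nonneg_of_le_pi hφ₀ (by linarith [pi_pos]))
  have h₂ := mul_nonneg hb₀.le (cos_nonneg_of_mem_Icc ⟨by linarith [pi_pos], hφ⟩)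
  rw [width, max_eq_left (max_le (by linarith) (by linarith)), cos_sub]
  nth_rw 1 [ha, hb]
  ring

lemma width_eq_of_le_pi_div_two_add {φ : ℝ} (hb : b = c * cos α) (ha : a = c * sin α)
    (hc : 0 < c) (hb₀ : 0 < b) (hα : α ≤ π / 2) (hφ₀ : π / 2 ≤ φ) (hφ : φ ≤ π / 2 + α) :
    width a b φ = a * cos (φ - π / 2) := by
  have h₁ := mul_nonneg hb₀.le
    (neg_nonneg.2 (cos_nonpos_of_pi_div_two_le_of_le hφ₀ (by linarith)))
  have h₂ := mul_nonneg hc.le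
    (cos_nonneg_of_mem_Icc (x := φ - α) ⟨by linarith [pi_pos], by linarith⟩)
  have h₃ : c * cos (φ - α) = b * cos φ + a * sin φ := by
    rw [cos_sub, ha, hb]
    ring
  rw [width, cos_sub_pi_div_two, max_eq_left (a := a * sin φ), max_eq_right] <;> linarith

lemma width_eq_of_pi_div_two_add_le {φ : ℝ} (hb : b = c * cos α) (ha : a = c * sin α)
    (hc : 0 < c) (ha₀ : 0 < a) (hα₀ : 0 ≤ α) (hφ₀ : π / 2 + α ≤ φ) (hφ : φ ≤ π) :
    width a b φ = b * cos (π - φ) := by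
  have h₁ := mul_nonneg ha₀.le (sin_nonneg_of_nonneg_of_le_pi (by linarith [pi_pos]) hφ)
  have h₂ := mul_nonneg hc.le
    (neg_nonneg.2 (cos_nonpos_of_pi_div_two_le_of_le (x := φ - α) (by linarith) (by linarith)))
  have h₃ : c * cos (φ - α) = b * cos φ + a * sin φ := by
    rw [cos_sub, ha, hb]
    ring
  rw [width, cos_pi_sub, max_eq_right (a := a * sin φ), max_eq_right] <;> linarith

lemma integral_shortMeasure_width (hb : b = c * cos α) (ha : a = c * sin α) (hc : 0 < c)
    (hb₀ : 0 < b) (ha₀ : 0 < a) (hα₀ : 0 ≤ α) (hα : α ≤ π / 2) (s : ℝ) :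
    ∫ φ in 0..π, shortMeasure a b s (width a b φ) =
      sectorIntegral a b s c α + sectorIntegral a b s c (π / 2 - α) + sectorIntegral a b s a α +
        sectorIntegral a b s b (π / 2 - α) := by
  have hint : ∀ x y, IntervalIntegrable (fun φ => shortMeasure a b s (width a b φ)) volume x y :=
    fun x y => ((continuous_shortMeasure a b s).comp (continuous_width a b)).intervalIntegrable x y
  have hpi := pi_pos
  have h₁ : (∫ φ in 0..π / 2, shortMeasure a b s (width a b φ)) =
      sectorIntegral a b s c α + sectorIntegral a b s c (π / 2 - α) := by
    calc (∫ φ in 0..π / 2, shortMeasure a b s (width a b φ))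
        = ∫ φ in 0..π / 2, shortMeasure a b s (c * cos (φ - α)) := by
          refine intervalIntegral.integral_congr fun φ hφ => ?_
          rw [Set.uIcc_of_le (by positivity)] at hφ
          simp only [width_eq_of_le_pi_div_two hb ha hb₀ ha₀ hφ.1 hφ.2]
      _ = ∫ t in 0 - α..π / 2 - α, shortMeasure a b s (c * cos t) :=
          intervalIntegral.integral_comp_sub_right (fun t => shortMeasure a b s (c * cos t)) α
      _ = (∫ t in 0 - α..0, shortMeasure a b s (c * cos t)) +
            sectorIntegral a b s c (π / 2 - α) :=
          (intervalIntegral.integral_add_adjacent_intervals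
            (intervalIntegrable_shortMeasure_mul_cos _ _ _ _ _ _)
            (intervalIntegrable_shortMeasure_mul_cos _ _ _ _ _ _)).symm
      _ = _ := by
          congr 1
          have := intervalIntegral.integral_comp_neg (a := 0) (b := α)
            (fun t => shortMeasure a b s (c * cos t))
          simpa [sectorIntegral] using this.symm
  have h₂ : (∫ φ in π / 2..π / 2 + α, shortMeasure a b s (width a b φ)) =
      sectorIntegral a b s a α := by
    calc (∫ φ in π / 2..π / 2 + α, shortMeasure a b s (width a b φ))
        = ∫ φ in π / 2..π / 2 + α, shortMeasure a b s (a * cos (φ - π / 2)) := by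
          refine intervalIntegral.integral_congr fun φ hφ => ?_
          rw [Set.uIcc_of_le (by linarith)] at hφ
          simp only [width_eq_of_le_pi_div_two_add hb ha hc hb₀ hα hφ.1 hφ.2]
      _ = _ := by
          rw [intervalIntegral.integral_comp_sub_right
            (fun t => shortMeasure a b s (a * cos t)) (π / 2), sub_self, add_sub_cancel_left,
            sectorIntegral]
  have h₃ : (∫ φ in π / 2 + α..π, shortMeasure a b s (width a b φ)) =
      sectorIntegral a b s b (π / 2 - α) := by
    calc (∫ φ in π / 2 + α..π, shortMeasure a b s (width a b φ))
        = ∫ φ in π / 2 + α..π, shortMeasure a b s (b * cos (π - φ)) := by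
          refine intervalIntegral.integral_congr fun φ hφ => ?_
          rw [Set.uIcc_of_le (by linarith)] at hφ
          simp only [width_eq_of_pi_div_two_add_le hb ha hc ha₀ hα₀ hφ.1 hφ.2]
      _ = _ := by
          rw [intervalIntegral.integral_comp_sub_left
            (fun t => shortMeasure a b s (b * cos t)) π, sub_self, sectorIntegral]
          congr 1
          ring
  rw [← intervalIntegral.integral_add_adjacent_intervals (hint 0 (π / 2)) (hint (π / 2) π),
    ← intervalIntegral.integral_add_adjacent_intervals (hint (π / 2) (π / 2 + α))
      (hint (π / 2 + α) π), h₁, h₂, h₃]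
  ring

/-- The measure of the lines with chord length at most `s`, as a sum over the sectors on which the
width is a multiple of a shifted cosine. -/
noncomputable def sectorSum (a b c α s : ℝ) : ℝ :=
  sectorIntegral a b s c α + sectorIntegral a b s c (π / 2 - α) + sectorIntegral a b s a α +
    sectorIntegral a b s b (π / 2 - α)

variable {h s : ℝ}

lemma sectorSum_of_le_altitude (hb : b = c * cos α) (ha : a = c * sin α) (hc : 0 < c) (hb₀ : 0 < b)
    (ha₀ : 0 < a) (hh : c * h = a * b) (hs₀ : 0 ≤ s) (hha : h ≤ a) (hab : a ≤ b) (hs : s ≤ h) :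
    sectorSum a b c α s =
      (a / b * (2 * α + π) + 2 * b / a * (π - α) + 6) * s / 4 := by
  have hh₀ : 0 < h := pos_of_mul_pos_right (hh ▸ mul_pos ha₀ hb₀) hc.le
  rw [sectorSum, sectorIntegral_of_le hh₀ hh hc hs₀ hs, sectorIntegral_of_le hh₀ hh hc hs₀ hs,
    sectorIntegral_of_le hb₀ rfl ha₀ hs₀ (by linarith),
    sectorIntegral_of_le ha₀ (mul_comm b a) hb₀ hs₀ (by linarith), sin_pi_div_two_sub,
    cos_pi_div_two_sub, hypotenuse_div_two_mul_altitude hb ha hc hb₀ ha₀ hh]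
  linear_combination (3 / 2 * s) * add_div_mul_sin_mul_cos hb ha hb₀ ha₀

lemma sectorSum_of_altitude_le (hb : b = c * cos α) (ha : a = c * sin α) (hc : 0 < c)
    (hb₀ : 0 < b) (ha₀ : 0 < a) (hα₀ : 0 ≤ α) (hα : α ≤ π / 2) (hh : c * h = a * b) (hab : a ≤ b)
    (hs : h ≤ s) (hsa : s ≤ a) :
    sectorSum a b c α s =
      (a / b * (2 * α - π) - 2 * b / a * α + 6) * s / 4 +
        (a / b + b / a) * (s * arcsin (h / s)) + c * √(1 - (h / s) ^ 2) := by
  have hh₀ : 0 < h := pos_of_mul_pos_right (hh ▸ mul_pos ha₀ hb₀) hc.le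
  have hs₀ : 0 ≤ s := hh₀.le.trans hs
  rw [sectorSum, sectorIntegral_of_mul_cos_le hh₀ hh hc hs hα₀ hα
      ((mul_le_iff_of_proportion hb hc hb₀ (hh.trans (mul_comm a b))).2 hsa),
    sectorIntegral_of_mul_cos_le hh₀ hh hc hs (by linarith) (by linarith)
      (by rw [cos_pi_div_two_sub]; exact (mul_le_iff_of_proportion ha hc ha₀ hh).2 (hsa.trans hab)),
    sectorIntegral_of_le hb₀ rfl ha₀ hs₀ (by linarith),
    sectorIntegral_of_le ha₀ (mul_comm b a) hb₀ hs₀ (by linarith), sin_pi_div_two_sub,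
    cos_pi_div_two_sub, hypotenuse_div_two_mul_altitude hb ha hc hb₀ ha₀ hh]
  linear_combination (3 / 2 * s) * add_div_mul_sin_mul_cos hb ha hb₀ ha₀

lemma sectorSum_of_short_leg_le (hb : b = c * cos α) (ha : a = c * sin α) (hc : 0 < c)
    (hb₀ : 0 < b) (ha₀ : 0 < a) (hα₀ : 0 ≤ α) (hα : α ≤ π / 2) (hh : c * h = a * b)
    (hha : h ≤ a) (hbc : b ≤ c) (hs : a ≤ s) (hsb : s ≤ b) :
    sectorSum a b c α s =
      a + (1 - b / a * α) * s + (a / b + b / a) / 2 * (s * arcsin (h / s)) +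
        c / 2 * √(1 - (h / s) ^ 2) + b / (2 * a) * (s * arcsin (a / s)) +
        b / 2 * √(1 - (a / s) ^ 2) := by
  have hh₀ : 0 < h := pos_of_mul_pos_right (hh ▸ mul_pos ha₀ hb₀) hc.le
  have hs₀ : 0 ≤ s := ha₀.le.trans hs
  rw [sectorSum, sectorIntegral_of_le_mul_cos hh₀ hh hc hs₀ hα₀ hα
      ((le_mul_iff_of_proportion hb hc hb₀ (hh.trans (mul_comm a b))).2 hs),
    sectorIntegral_of_mul_cos_le hh₀ hh hc (hha.trans hs) (by linarith) (by linarith)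
      (by rw [cos_pi_div_two_sub]; exact (mul_le_iff_of_proportion ha hc ha₀ hh).2 hsb),
    sectorIntegral_of_le hb₀ rfl ha₀ hs₀ hsb,
    sectorIntegral_of_mul_cos_le ha₀ (mul_comm b a) hb₀ hs (by linarith) (by linarith)
      (by rw [cos_pi_div_two_sub]; exact
          (mul_le_iff_of_proportion ha hc ha₀ (mul_comm c a)).2 (hsb.trans hbc)),
    sin_pi_div_two_sub, cos_pi_div_two_sub, ← ha,
    hypotenuse_div_two_mul_altitude hb ha hc hb₀ ha₀ hh]
  linear_combination s * add_div_mul_sin_mul_cos hb ha hb₀ ha₀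

lemma sectorSum_of_long_leg_le (hb : b = c * cos α) (ha : a = c * sin α) (hc : 0 < c)
    (hb₀ : 0 < b) (ha₀ : 0 < a) (hα₀ : 0 ≤ α) (hα : α ≤ π / 2) (hh : c * h = a * b)
    (hab : a ≤ b) (hs : b ≤ s) (hsc : s ≤ c) :
    sectorSum a b c α s =
      a + b + (a / b * (2 * α - π) - 2 * b / a * α + 2) * s / 4 +
        b / (2 * a) * (s * arcsin (a / s)) + b / 2 * √(1 - (a / s) ^ 2) +
        a / (2 * b) * (s * arcsin (b / s)) + a / 2 * √(1 - (b / s) ^ 2) := by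
  have hh₀ : 0 < h := pos_of_mul_pos_right (hh ▸ mul_pos ha₀ hb₀) hc.le
  have hs₀ : 0 ≤ s := hb₀.le.trans hs
  rw [sectorSum, sectorIntegral_of_le_mul_cos hh₀ hh hc hs₀ hα₀ hα
      ((le_mul_iff_of_proportion hb hc hb₀ (hh.trans (mul_comm a b))).2 (hab.trans hs)),
    sectorIntegral_of_le_mul_cos hh₀ hh hc hs₀ (by linarith) (by linarith)
      (by rw [cos_pi_div_two_sub]; exact (le_mul_iff_of_proportion ha hc ha₀ hh).2 hs),
    sectorIntegral_of_mul_cos_le hb₀ rfl ha₀ hs hα₀ hα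
      ((mul_le_iff_of_proportion hb hc hb₀ (mul_comm c b)).2 hsc),
    sectorIntegral_of_mul_cos_le ha₀ (mul_comm b a) hb₀ (hab.trans hs) (by linarith)
      (by linarith)
      (by rw [cos_pi_div_two_sub]; exact (mul_le_iff_of_proportion ha hc ha₀ (mul_comm c a)).2 hsc),
    sin_pi_div_two_sub, cos_pi_div_two_sub, ← ha, ← hb]
  linear_combination (1 / 2 * s) * add_div_mul_sin_mul_cos hb ha hb₀ ha₀

lemma sectorSum_of_hypotenuse_le (hb : b = c * cos α) (ha : a = c * sin α) (hc : 0 < c)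
    (hb₀ : 0 < b) (ha₀ : 0 < a) (hα₀ : 0 ≤ α) (hα : α ≤ π / 2) (hh : c * h = a * b)
    (hab : a ≤ b) (hbc : b ≤ c) (hs : c ≤ s) :
    sectorSum a b c α s = a + b + c := by
  have hh₀ : 0 < h := pos_of_mul_pos_right (hh ▸ mul_pos ha₀ hb₀) hc.le
  have hs₀ : 0 ≤ s := hc.le.trans hs
  have hbs := hbc.trans hs
  rw [sectorSum, sectorIntegral_of_le_mul_cos hh₀ hh hc hs₀ hα₀ hα
      ((le_mul_iff_of_proportion hb hc hb₀ (hh.trans (mul_comm a b))).2 (hab.trans hbs)),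
    sectorIntegral_of_le_mul_cos hh₀ hh hc hs₀ (by linarith) (by linarith)
      (by rw [cos_pi_div_two_sub]; exact (le_mul_iff_of_proportion ha hc ha₀ hh).2 hbs),
    sectorIntegral_of_le_mul_cos hb₀ rfl ha₀ hs₀ hα₀ hα
      ((le_mul_iff_of_proportion hb hc hb₀ (mul_comm c b)).2 hs),
    sectorIntegral_of_le_mul_cos ha₀ (mul_comm b a) hb₀ hs₀ (by linarith) (by linarith)
      (by rw [cos_pi_div_two_sub]; exact (le_mul_iff_of_proportion ha hc ha₀ (mul_comm c a)).2 hs),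
    sin_pi_div_two_sub, ← ha, ← hb]
  linear_combination sin α * ha + cos α * hb + c * sin_sq_add_cos_sq α

end Hypotenuse

end RightTriangleChord

/-- The chord length distribution of a right-angled triangle with legs `a ≤ b`:
the measure of the set of lines producing a chord of length at most `s`. -/
theorem chord_length_distribution_right_triangle
    (a b c α u h : ℝ) (ha : 0 < a) (hab : a ≤ b)
    (hc : c = Real.sqrt (a ^ 2 + b ^ 2))
    (hα : α = Real.arctan (a / b))
    (hu : u = a + b + c)
    (hh : h = a * b / c)
    (T : Set (EuclideanSpace ℝ (Fin 2)))
    (hT : T = {P | 0 ≤ P 0 ∧ 0 ≤ P 1 ∧ b * P 0 + a * P 1 ≤ a * b})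
    (line : ℝ → ℝ → Set (EuclideanSpace ℝ (Fin 2)))
    (hline : ∀ p φ, line p φ = {P | -(P 0) * Real.sin φ + P 1 * Real.cos φ = p})
    (M : ℝ → Set (ℝ × ℝ))
    (hM : ∀ s, M s = {q : ℝ × ℝ | q.2 ∈ Set.Ico 0 π ∧
      (line q.1 q.2 ∩ T).Nonempty ∧ μH[1] (line q.1 q.2 ∩ T) ≤ ENNReal.ofReal s})
    (Θ₁ Θ₂ Θ₃ Θ₄ Θ₅ Θ₆ : ℝ)
    (hΘ₁ : Θ₁ = (a / b) * (2 * α + π) + (2 * b / a) * (π - α) + 6)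
    (hΘ₂ : Θ₂ = (a / b) * (2 * α - π) - (2 * b / a) * α + 6)
    (hΘ₃ : Θ₃ = a / b + b / a)
    (hΘ₄ : Θ₄ = 1 - (b / a) * α)
    (hΘ₅ : Θ₅ = a + b)
    (hΘ₆ : Θ₆ = (a / b) * (2 * α - π) - (2 * b / a) * α + 2)
    (L₁ L₂ : ℝ → ℝ → ℝ)
    (hL₁ : ∀ s r, L₁ s r = s * Real.arcsin (r / s))
    (hL₂ : ∀ s r, L₂ s r = Real.sqrt (1 - (r / s) ^ 2))
    (H₁ H₂ H₃ H₄ : ℝ → ℝ)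
    (hH₁ : ∀ s, H₁ s = Θ₁ * s / 4)
    (hH₂ : ∀ s, H₂ s = Θ₂ * s / 4 + Θ₃ * L₁ s h + c * L₂ s h)
    (hH₃ : ∀ s, H₃ s = a + Θ₄ * s + (Θ₃ / 2) * L₁ s h + (c / 2) * L₂ s h
      + (b / (2 * a)) * L₁ s a + (b / 2) * L₂ s a)
    (hH₄ : ∀ s, H₄ s = Θ₅ + Θ₆ * s / 4 + (b / (2 * a)) * L₁ s a + (b / 2) * L₂ s a
      + (a / (2 * b)) * L₁ s b + (a / 2) * L₂ s b) :
    ∀ s : ℝ,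
      (s < 0 → volume (M s) = 0) ∧
      (0 ≤ s → s < h → volume (M s) = ENNReal.ofReal (H₁ s)) ∧
      (h ≤ s → s < a → volume (M s) = ENNReal.ofReal (H₂ s)) ∧
      (a ≤ s → s < b → volume (M s) = ENNReal.ofReal (H₃ s)) ∧
      (b ≤ s → s < c → volume (M s) = ENNReal.ofReal (H₄ s)) ∧
      (c ≤ s → volume (M s) = ENNReal.ofReal u) := by
  have hb : 0 < b := ha.trans_le hab
  have hc₀ : 0 < c := by rw [hc]; positivity
  have hα₀ : 0 < α := by rw [hα]; exact Real.arctan_pos.2 (div_pos ha hb)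
  have hα₁ : α < π / 2 := by rw [hα]; exact Real.arctan_lt_pi_div_two _
  have hsqrt : √(1 + (a / b) ^ 2) = c / b := by
    rw [hc, Real.sqrt_eq_iff_mul_self_eq (by positivity) (by positivity), div_mul_div_comm,
      Real.mul_self_sqrt (by positivity)]
    field_simp
    ring
  have hcos : Real.cos α = b / c := by rw [hα, Real.cos_arctan, hsqrt, one_div_div]
  have hsin : Real.sin α = a / c := by rw [hα, Real.sin_arctan, hsqrt]; field_simp
  have hbc : b = c * Real.cos α := by rw [hcos]; field_simp
  have hac : a = c * Real.sin α := by rw [hsin]; field_simp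
  have hhpos : 0 < h := by rw [hh]; positivity
  have hch : c * h = a * b := by rw [hh]; field_simp
  have hbltc : b < c := by rw [hc]; exact Real.lt_sqrt_of_sq_lt (by nlinarith)
  have hha : h ≤ a := by
    rw [hh, div_le_iff₀ hc₀]
    exact mul_le_mul_of_nonneg_left hbltc.le ha.le
  have hM' : ∀ s, M s = RightTriangleChord.shortLines a b s := by
    intro s
    rw [hM]
    ext q
    simp only [RightTriangleChord.shortLines, Set.mem_ofPred_eq, hline, hT,
      RightTriangleChord.line_inter_triangle_eq_image, Set.image_nonempty,
      RightTriangleChord.hausdorffMeasure_lineParam_image]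
  have hvol : ∀ s, 0 ≤ s →
      volume (M s) = ENNReal.ofReal (RightTriangleChord.sectorSum a b c α s) := by
    intro s hs
    rw [hM', RightTriangleChord.volume_shortLines ha hb hs,
      RightTriangleChord.integral_shortMeasure_width hbc hac hc₀ hb ha hα₀.le hα₁.le,
      RightTriangleChord.sectorSum]
  intro s
  refine ⟨fun hs => ?_, fun hs₀ hs => ?_, fun hs₁ hs => ?_, fun hs₁ hs => ?_, fun hs₁ hs => ?_,
    fun hs₁ => ?_⟩
  · rw [hM', ← RightTriangleChord.shortLines_max_zero, max_eq_right hs.le, ← hM', hvol 0 le_rfl]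
    simp [RightTriangleChord.sectorSum, RightTriangleChord.sectorIntegral,
      RightTriangleChord.shortMeasure]
  · rw [hvol s hs₀, hH₁, hΘ₁,
      RightTriangleChord.sectorSum_of_le_altitude hbc hac hc₀ hb ha hch hs₀ hha hab hs.le]
  · rw [hvol s (hhpos.le.trans hs₁), hH₂, hΘ₂, hΘ₃, hL₁, hL₂,
      RightTriangleChord.sectorSum_of_altitude_le hbc hac hc₀ hb ha hα₀.le hα₁.le hch hab hs₁ hs.le]
  · rw [hvol s (ha.le.trans hs₁), hH₃, hΘ₃, hΘ₄, hL₁, hL₂, hL₁, hL₂,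
      RightTriangleChord.sectorSum_of_short_leg_le hbc hac hc₀ hb ha hα₀.le hα₁.le hch hha
        hbltc.le hs₁ hs.le]
  · rw [hvol s (hb.le.trans hs₁), hH₄, hΘ₅, hΘ₆, hL₁, hL₂, hL₁, hL₂,
      RightTriangleChord.sectorSum_of_long_leg_le hbc hac hc₀ hb ha hα₀.le hα₁.le hch hab hs₁ hs.le]
  · rw [hvol s (hc₀.le.trans hs₁), hu,
      RightTriangleChord.sectorSum_of_hypotenuse_le hbc hac hc₀ hb ha hα₀.le hα₁.le hch hab
        hbltc.le hs₁]
end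

section
/- For every t with 0 ≤ t ≤ c, the four-dimensional Lebesgue measure of the set {(P,Q) ∈ T × T : ‖P − Q‖ ≤ t} equals A² · ∫₀ᵗ g(τ) dτ, where g(τ) = (2τ/A)·[π + (J*(τ) − u·τ)/A]. In other words, g is the probability density function of the distance between two independent uniformly distributed random points in T. -/
open Real MeasureTheory

/-- The integral of the square of the positive part of `1 - k cos ψ` over `[0, β]`. -/
noncomputable def capIntegral (k β : ℝ) : ℝ := ∫ ψ in (0 : ℝ)..β, (max 0 (1 - k * cos ψ)) ^ 2

theorem integral_one_sub_mul_cos_sq (k β γ : ℝ) :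
    ∫ ψ in γ..β, (1 - k * cos ψ) ^ 2 = (β - γ) - 2 * k * (sin β - sin γ)
      + k ^ 2 * ((β - γ) + (sin β * cos β - sin γ * cos γ)) / 2 := by
  have hderiv : ∀ ψ ∈ Set.uIcc γ β, HasDerivAt
      (fun ψ => ψ - 2 * k * sin ψ + k ^ 2 * (ψ + sin ψ * cos ψ) / 2)
      ((1 - k * cos ψ) ^ 2) ψ := by
    intro ψ _
    have h1 := (((hasDerivAt_id ψ).sub ((hasDerivAt_sin ψ).const_mul (2 * k))).add
      ((((hasDerivAt_id ψ).add ((hasDerivAt_sin ψ).mul (hasDerivAt_cos ψ))).const_mul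
        (k ^ 2)).div_const 2))
    refine h1.congr_deriv ?_
    linear_combination (-(k ^ 2) / 2) * sin_sq_add_cos_sq ψ
  rw [intervalIntegral.integral_eq_sub_of_hasDerivAt hderiv
    (Continuous.intervalIntegrable (by fun_prop) _ _)]
  ring

theorem capIntegral_of_le_one {k : ℝ} (β : ℝ) (hk0 : 0 ≤ k) (hk1 : k ≤ 1) :
    capIntegral k β = β - 2 * k * sin β + k ^ 2 * (β + sin β * cos β) / 2 := by
  have h := integral_one_sub_mul_cos_sq k β 0
  simp only [sub_zero, sin_zero, zero_mul] at h
  rw [← h, capIntegral]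
  refine intervalIntegral.integral_congr fun ψ _ => ?_
  have : k * cos ψ ≤ 1 := by nlinarith [cos_le_one ψ]
  rw [max_eq_right (by linarith)]

theorem capIntegral_of_le_arccos {d r β : ℝ} (hd : 0 < d) (hdr : d ≤ r) (hβ0 : 0 ≤ β)
    (hβ : β ≤ arccos (d / r)) : capIntegral (r / d) β = 0 := by
  have hr : 0 < r := hd.trans_le hdr
  refine (intervalIntegral.integral_congr (g := fun _ => (0 : ℝ)) fun ψ hψ => ?_).trans (by simp)
  rw [Set.uIcc_of_le hβ0] at hψ
  have h1 : d / r ≤ cos ψ := by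
    have := cos_le_cos_of_nonneg_of_le_pi hψ.1 (arccos_le_pi _) (hψ.2.trans hβ)
    rwa [cos_arccos (by have : 0 < d / r := by positivity
                        linarith) ((div_le_one hr).2 hdr)] at this
  have h2 : 1 ≤ r / d * cos ψ := by
    calc (1 : ℝ) = r / d * (d / r) := by field_simp
      _ ≤ _ := by gcongr
  rw [max_eq_left (by linarith)]
  norm_num

theorem capIntegral_of_arccos_le {d r β : ℝ} (hd : 0 < d) (hdr : d ≤ r) (hβπ : β ≤ π)
    (hβ : arccos (d / r) ≤ β) :
    capIntegral (r / d) β = (β - (π / 2 - arcsin (d / r)))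
      - 2 * (r / d) * (sin β - √(r ^ 2 - d ^ 2) / r)
      + (r / d) ^ 2 * ((β - (π / 2 - arcsin (d / r)))
        + (sin β * cos β - √(r ^ 2 - d ^ 2) / r * (d / r))) / 2 := by
  have hr : 0 < r := hd.trans_le hdr
  have h0 : 0 < d / r := by positivity
  have h1 : d / r ≤ 1 := (div_le_one hr).2 hdr
  have hcos : cos (arccos (d / r)) = d / r := cos_arccos (by linarith) h1
  have hsin : sin (arccos (d / r)) = √(r ^ 2 - d ^ 2) / r := by
    rw [sin_arccos, ← sqrt_sq hr.le, ← sqrt_div' _ (sq_nonneg _), sqrt_sq hr.le]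
    congr 1
    field_simp
  have hfi : ∀ x y : ℝ, IntervalIntegrable (fun ψ => (max 0 (1 - r / d * cos ψ)) ^ 2)
      volume x y := fun x y => Continuous.intervalIntegrable (by fun_prop) _ _
  rw [capIntegral, ← intervalIntegral.integral_add_adjacent_intervals
    (hfi 0 (arccos (d / r))) (hfi _ _)]
  have hz := capIntegral_of_le_arccos hd hdr (arccos_nonneg (d / r)) le_rfl
  rw [capIntegral] at hz
  rw [hz, zero_add, ← hcos, ← hsin, hcos, ← arccos_eq_pi_div_two_sub_arcsin]
  have hmain := integral_one_sub_mul_cos_sq (r / d) β (arccos (d / r))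
  rw [hcos] at hmain
  rw [← hmain]
  refine intervalIntegral.integral_congr fun ψ hψ => ?_
  rw [Set.uIcc_of_le hβ] at hψ
  have h3 : cos ψ ≤ d / r := by
    have := cos_le_cos_of_nonneg_of_le_pi (arccos_nonneg _) (hψ.2.trans hβπ) hψ.1
    rwa [hcos] at this
  have h2 : r / d * cos ψ ≤ 1 := by
    calc _ ≤ r / d * (d / r) := by gcongr
      _ = (1 : ℝ) := by field_simp
  rw [max_eq_right (by linarith)]

/-- The hexagonal gauge of the differences of points in the triangle with legs `a` and `b`. -/
noncomputable def hexGauge (a b p q : ℝ) : ℝ :=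
  max 0 (p / a) + max 0 (q / b) + max 0 (-(p / a + q / b))

theorem hexGauge_neg (a b p q : ℝ) : hexGauge a b (-p) (-q) = hexGauge a b p q := by
  have key : ∀ x : ℝ, max 0 (-x) = max 0 x - x := by
    intro x
    rcases le_total 0 x with h | h
    · rw [max_eq_left (by linarith), max_eq_right h]; ring
    · rw [max_eq_right (by linarith), max_eq_left h]; ring
  rw [hexGauge, hexGauge, neg_div, neg_div, key, key, ← neg_add, neg_neg, key]
  ring

theorem continuous_hexGauge {X : Type*} [TopologicalSpace X] (a b : ℝ) {f g : X → ℝ}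
    (hf : Continuous f) (hg : Continuous g) : Continuous fun x => hexGauge a b (f x) (g x) := by
  unfold hexGauge
  fun_prop

theorem hexGauge_of_nonneg {a b p q : ℝ} (ha : 0 < a) (hb : 0 < b) (hp : 0 ≤ p) (hq : 0 ≤ q) :
    hexGauge a b p q = p / a + q / b := by
  have h1 : 0 ≤ p / a := by positivity
  have h2 : 0 ≤ q / b := by positivity
  rw [hexGauge, max_eq_right h1, max_eq_right h2, max_eq_left (by linarith), add_zero]

theorem hexGauge_of_nonpos_of_le {a b p q : ℝ} (ha : 0 < a) (hb : 0 < b) (hp : 0 ≤ p)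
    (hq : 0 ≤ q) (h : p / a ≤ q / b) : hexGauge a b (-p) q = q / b := by
  have h1 : 0 ≤ p / a := by positivity
  have h2 : 0 ≤ q / b := by positivity
  rw [hexGauge, neg_div, max_eq_left (by linarith), max_eq_right h2, max_eq_left (by linarith)]
  ring

theorem hexGauge_of_nonpos_of_ge {a b p q : ℝ} (ha : 0 < a) (hb : 0 < b) (hp : 0 ≤ p)
    (hq : 0 ≤ q) (h : q / b ≤ p / a) : hexGauge a b (-p) q = p / a := by
  have h1 : 0 ≤ p / a := by positivity
  have h2 : 0 ≤ q / b := by positivity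
  rw [hexGauge, neg_div, max_eq_left (by linarith), max_eq_right h2, max_eq_right (by linarith)]
  ring

theorem integral_hexGauge_polar {c α : ℝ} (r : ℝ) (hc : 0 < c) (hα0 : 0 < α) (hα1 : α < π / 2) :
    ∫ θ in (-π)..π, (max 0 (1 - r * hexGauge (c * sin α) (c * cos α) (cos θ) (sin θ))) ^ 2
      = 2 * (capIntegral (r / (c * sin α * cos α)) α
        + capIntegral (r / (c * sin α * cos α)) (π / 2 - α)
        + capIntegral (r / (c * sin α)) (π / 2 - α) + capIntegral (r / (c * cos α)) α) := by
  have hS : 0 < sin α := sin_pos_of_pos_of_lt_pi hα0 (by linarith)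
  have hC : 0 < cos α := cos_pos_of_mem_Ioo ⟨by linarith, hα1⟩
  set f : ℝ → ℝ := fun θ =>
    (max 0 (1 - r * hexGauge (c * sin α) (c * cos α) (cos θ) (sin θ))) ^ 2 with hf
  have hcont : Continuous f := by
    have := continuous_hexGauge (c * sin α) (c * cos α) continuous_cos continuous_sin
    fun_prop
  have hfi : ∀ x y : ℝ, IntervalIntegrable f volume x y := fun x y =>
    hcont.intervalIntegrable _ _
  have hneg : ∫ θ in (-π)..0, f θ = ∫ θ in (0 : ℝ)..π, f θ := by
    have := intervalIntegral.integral_comp_sub_right (a := 0) (b := π) f π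
    rw [zero_sub, sub_self] at this
    rw [← this]
    refine intervalIntegral.integral_congr fun θ _ => ?_
    simp only [hf, cos_sub_pi, sin_sub_pi, hexGauge_neg]
  have hfirst : ∫ θ in (0 : ℝ)..(π / 2), f θ = capIntegral (r / (c * sin α * cos α)) α
        + capIntegral (r / (c * sin α * cos α)) (π / 2 - α) := by
    set k := r / (c * sin α * cos α) with hk
    have h1 := intervalIntegral.integral_comp_sub_right (a := 0) (b := π / 2)
      (fun ψ => (max 0 (1 - k * cos ψ)) ^ 2) α
    have h2 : ∫ θ in (0 : ℝ)..(π / 2), f θ =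
        ∫ θ in (0 : ℝ)..(π / 2), (max 0 (1 - k * cos (θ - α))) ^ 2 := by
      refine intervalIntegral.integral_congr fun θ hθ => ?_
      rw [Set.uIcc_of_le (by positivity)] at hθ
      simp only [hf]
      rw [hexGauge_of_nonneg (by positivity) (by positivity)
        (cos_nonneg_of_mem_Icc ⟨by linarith [hθ.1], hθ.2⟩)
        (sin_nonneg_of_nonneg_of_le_pi hθ.1 (by linarith [hθ.2])), cos_sub, hk]
      congr 3
      field_simp
    have h3 := intervalIntegral.integral_comp_neg (a := 0) (b := α)
      (fun ψ => (max 0 (1 - k * cos ψ)) ^ 2)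
    simp only [cos_neg, neg_zero] at h3
    have hfi' : ∀ x y : ℝ, IntervalIntegrable (fun ψ => (max 0 (1 - k * cos ψ)) ^ 2)
      volume x y := fun x y => Continuous.intervalIntegrable (by fun_prop) _ _
    rw [h2, h1, zero_sub, ← intervalIntegral.integral_add_adjacent_intervals
      (hfi' (-α) 0) (hfi' _ _), ← h3]
    rfl
  have hsecond : ∫ θ in (π / 2)..π, f θ = capIntegral (r / (c * sin α)) (π / 2 - α)
      + capIntegral (r / (c * cos α)) α := by
    have h1 := intervalIntegral.integral_comp_add_right (a := 0) (b := π / 2) f (π / 2)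
    rw [zero_add, add_halves] at h1
    have hfi' : ∀ x y : ℝ, IntervalIntegrable (fun θ => f (θ + π / 2)) volume x y :=
      fun x y => Continuous.intervalIntegrable (by fun_prop) _ _
    have hcmp : ∀ θ, sin θ * cos α - cos θ * sin α = sin (θ - α) := fun θ => (sin_sub θ α).symm
    have h2 : ∫ θ in (0 : ℝ)..α, f (θ + π / 2) = capIntegral (r / (c * cos α)) α := by
      refine intervalIntegral.integral_congr fun θ hθ => ?_
      rw [Set.uIcc_of_le hα0.le] at hθ
      have hs : sin (θ - α) ≤ 0 := sin_nonpos_of_nonpos_of_neg_pi_le (by linarith [hθ.2])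
        (by linarith [hθ.1])
      simp only [hf, cos_add_pi_div_two, sin_add_pi_div_two]
      rw [hexGauge_of_nonpos_of_le (by positivity) (by positivity)
        (sin_nonneg_of_nonneg_of_le_pi hθ.1 (by linarith [hθ.2]))
        (cos_nonneg_of_mem_Icc ⟨by linarith [hθ.1], by linarith [hθ.2]⟩)]
      · ring_nf
      · rw [div_le_div_iff₀ (by positivity) (by positivity)]
        nlinarith [hcmp θ]
    have h3 : ∫ θ in α..(π / 2), f (θ + π / 2) = capIntegral (r / (c * sin α)) (π / 2 - α) := by
      have h4 := intervalIntegral.integral_comp_sub_left (a := 0) (b := π / 2 - α)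
        (fun θ => f (θ + π / 2)) (π / 2)
      rw [sub_zero, sub_sub_cancel] at h4
      rw [← h4]
      refine intervalIntegral.integral_congr fun θ hθ => ?_
      rw [Set.uIcc_of_le (by linarith)] at hθ
      have hs : 0 ≤ sin (π / 2 - θ - α) := sin_nonneg_of_nonneg_of_le_pi (by linarith [hθ.2])
        (by linarith [hθ.1])
      have := hcmp (π / 2 - θ)
      simp only [sin_pi_div_two_sub, cos_pi_div_two_sub] at this
      simp only [hf, cos_add_pi_div_two, sin_add_pi_div_two, sin_pi_div_two_sub,
        cos_pi_div_two_sub]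
      rw [hexGauge_of_nonpos_of_ge (by positivity) (by positivity)
        (cos_nonneg_of_mem_Icc ⟨by linarith [hθ.1], by linarith [hθ.2]⟩)
        (sin_nonneg_of_nonneg_of_le_pi hθ.1 (by linarith [hθ.2]))]
      · ring_nf
      · rw [div_le_div_iff₀ (by positivity) (by positivity)]
        nlinarith
    rw [← h1, ← intervalIntegral.integral_add_adjacent_intervals (hfi' 0 α) (hfi' _ _), h2, h3,
      add_comm]
  rw [← intervalIntegral.integral_add_adjacent_intervals (hfi (-π) 0) (hfi _ _), hneg,
    ← intervalIntegral.integral_add_adjacent_intervals (hfi 0 (π / 2)) (hfi _ _), hfirst,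
    hsecond]
  ring

theorem volume_right_triangle {a b : ℝ} (ha : 0 < a) (hb : 0 < b) (x₀ y₀ s : ℝ) :
    volume {P : ℝ × ℝ | x₀ ≤ P.1 ∧ y₀ ≤ P.2 ∧ b * P.1 + a * P.2 ≤ s}
      = ENNReal.ofReal ((max 0 (s - b * x₀ - a * y₀)) ^ 2 / (2 * a * b)) := by
  rcases le_total (s - b * x₀ - a * y₀) 0 with hσ | hσ
  · rw [max_eq_left hσ]
    have hsub : {P : ℝ × ℝ | x₀ ≤ P.1 ∧ y₀ ≤ P.2 ∧ b * P.1 + a * P.2 ≤ s} ⊆ {(x₀, y₀)} := by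
      rintro ⟨x, y⟩ ⟨h1, h2, h3⟩
      simp only at h1 h2 h3
      simp only [Set.mem_singleton_iff, Prod.mk.injEq]
      constructor
      · by_contra hne
        have := lt_of_le_of_ne h1 (Ne.symm hne)
        nlinarith
      · by_contra hne
        have := lt_of_le_of_ne h2 (Ne.symm hne)
        nlinarith
    rw [measure_mono_null hsub (measure_singleton _)]
    simp
  · rw [max_eq_right hσ]
    set x₁ := x₀ + (s - b * x₀ - a * y₀) / b with hx₁
    have hx : x₀ ≤ x₁ := by
      have : 0 ≤ (s - b * x₀ - a * y₀) / b := by positivity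
      linarith
    have hbx₁ : b * x₁ = s - a * y₀ := by
      rw [hx₁]; field_simp; ring
    have hmeas : MeasurableSet {P : ℝ × ℝ | x₀ ≤ P.1 ∧ y₀ ≤ P.2 ∧ b * P.1 + a * P.2 ≤ s} := by
      measurability
    rw [Measure.volume_eq_prod, Measure.prod_apply hmeas]
    have hsec : ∀ x : ℝ, volume (Prod.mk x ⁻¹'
        {P : ℝ × ℝ | x₀ ≤ P.1 ∧ y₀ ≤ P.2 ∧ b * P.1 + a * P.2 ≤ s})
        = (Set.Icc x₀ x₁).indicator (fun x => ENNReal.ofReal ((s - b * x) / a - y₀)) x := by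
      intro x
      by_cases hxm : x ∈ Set.Icc x₀ x₁
      · rw [Set.indicator_of_mem hxm, ← Real.volume_Icc]
        congr 1
        ext y
        simp only [Set.mem_preimage, Set.mem_ofPred_eq, Set.mem_Icc, le_div_iff₀ ha]
        constructor
        · rintro ⟨_, h2, h3⟩
          exact ⟨h2, by linarith⟩
        · rintro ⟨h2, h3⟩
          exact ⟨hxm.1, h2, by linarith⟩
      · rw [Set.indicator_of_notMem hxm]
        refine measure_mono_null (t := ∅) ?_ measure_empty
        rintro y ⟨h1, h2, h3⟩
        simp only at h1 h2 h3
        refine hxm ⟨h1, ?_⟩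
        have : b * x ≤ b * x₁ := by nlinarith
        exact le_of_mul_le_mul_left this hb
    simp_rw [hsec]
    rw [lintegral_indicator measurableSet_Icc, ← ofReal_integral_eq_lintegral_ofReal,
      integral_Icc_eq_integral_Ioc, ← intervalIntegral.integral_of_le hx]
    · congr 1
      have hd : ∀ x ∈ Set.uIcc x₀ x₁, HasDerivAt
          (fun x => (s * x - b * (x ^ 2 / 2)) / a - y₀ * x) ((s - b * x) / a - y₀) x := by
        intro x _
        have := ((((hasDerivAt_id x).const_mul s).sub
          ((((hasDerivAt_id x).pow 2).div_const 2).const_mul b)).div_const a).sub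
          ((hasDerivAt_id x).const_mul y₀)
        refine this.congr_deriv ?_
        simp only [id]
        ring
      rw [intervalIntegral.integral_eq_sub_of_hasDerivAt hd
        (Continuous.intervalIntegrable (by fun_prop) _ _), hx₁]
      field_simp
      ring
    · exact (Continuous.integrableOn_Icc (by fun_prop))
    · refine (ae_restrict_iff' measurableSet_Icc).2 (Filter.Eventually.of_forall fun x hxm => ?_)
      have : b * x ≤ b * x₁ := mul_le_mul_of_nonneg_left hxm.2 hb.le
      simp only [Pi.zero_apply, sub_nonneg, le_div_iff₀ ha]
      linarith

theorem volume_right_triangle_inter_translate {a b : ℝ} (ha : 0 < a) (hb : 0 < b) (p q : ℝ) :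
    volume {P : ℝ × ℝ | (0 ≤ P.1 ∧ 0 ≤ P.2 ∧ b * P.1 + a * P.2 ≤ a * b) ∧
        (0 ≤ P.1 + p ∧ 0 ≤ P.2 + q ∧ b * (P.1 + p) + a * (P.2 + q) ≤ a * b)}
      = ENNReal.ofReal (a * b / 2 * (max 0 (1 - hexGauge a b p q)) ^ 2) := by
  have hset : {P : ℝ × ℝ | (0 ≤ P.1 ∧ 0 ≤ P.2 ∧ b * P.1 + a * P.2 ≤ a * b) ∧
        (0 ≤ P.1 + p ∧ 0 ≤ P.2 + q ∧ b * (P.1 + p) + a * (P.2 + q) ≤ a * b)}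
      = {P : ℝ × ℝ | max 0 (-p) ≤ P.1 ∧ max 0 (-q) ≤ P.2 ∧
          b * P.1 + a * P.2 ≤ a * b - max 0 (b * p + a * q)} := by
    ext ⟨x, y⟩
    simp only [Set.mem_ofPred_eq]
    rw [le_sub_comm, max_le_iff, max_le_iff, max_le_iff]
    constructor
    · rintro ⟨⟨h1, h2, h3⟩, h4, h5, h6⟩
      exact ⟨⟨h1, by linarith⟩, ⟨h2, by linarith⟩, by linarith, by linarith⟩
    · rintro ⟨⟨h1, h2⟩, ⟨h3, h4⟩, h5, h6⟩
      exact ⟨⟨h1, h3, by linarith⟩, by linarith, by linarith, by linarith⟩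
  have hσ : a * b - max 0 (b * p + a * q) - b * max 0 (-p) - a * max 0 (-q)
      = a * b * (1 - hexGauge a b p q) := by
    rw [← hexGauge_neg, hexGauge, mul_sub, mul_add, mul_add,
      mul_max_of_nonneg _ _ (by positivity : 0 ≤ a * b),
      mul_max_of_nonneg _ _ (by positivity : 0 ≤ a * b),
      mul_max_of_nonneg _ _ (by positivity : 0 ≤ a * b),
      mul_max_of_nonneg _ _ ha.le, mul_max_of_nonneg _ _ hb.le]
    have e1 : a * b * (-p / a) = b * -p := by field_simp
    have e2 : a * b * (-q / b) = a * -q := by field_simp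
    have e3 : a * b * -(-p / a + -q / b) = b * p + a * q := by field_simp; ring
    rw [e1, e2, e3]
    simp only [mul_zero]
    ring
  rw [hset, volume_right_triangle ha hb, hσ]
  have hm : max 0 (a * b * (1 - hexGauge a b p q)) = a * b * max 0 (1 - hexGauge a b p q) := by
    rw [mul_max_of_nonneg _ _ (by positivity : 0 ≤ a * b), mul_zero]
  rw [hm]
  congr 1
  field_simp

theorem lintegral_disk_eq_integral_polar {f : ℝ × ℝ → ℝ} (hf : Continuous f) (hf0 : ∀ v, 0 ≤ f v)
    {t : ℝ} (ht : 0 ≤ t) :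
    ∫⁻ v : ℝ × ℝ in {v | v.1 ^ 2 + v.2 ^ 2 ≤ t ^ 2}, ENNReal.ofReal (f v)
      = ENNReal.ofReal (∫ r in (0 : ℝ)..t, r * ∫ θ in (-π)..π, f (r * cos θ, r * sin θ)) := by
  have hms : MeasurableSet {v : ℝ × ℝ | v.1 ^ 2 + v.2 ^ 2 ≤ t ^ 2} :=
    (isClosed_le (by fun_prop) (by fun_prop)).measurableSet
  rw [← lintegral_indicator hms, ← lintegral_comp_polarCoord_symm]
  have htarget : polarCoord.target = Set.Ioi (0 : ℝ) ×ˢ Set.Ioo (-π) π := rfl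
  have hπ : -π ≤ π := by linarith [pi_pos]
  have hinner : ∀ r ∈ Set.Ioi (0 : ℝ), (∫⁻ θ in Set.Ioo (-π) π, ENNReal.ofReal r •
        ({v : ℝ × ℝ | v.1 ^ 2 + v.2 ^ 2 ≤ t ^ 2}.indicator (fun v => ENNReal.ofReal (f v))
          (polarCoord.symm (r, θ))))
      = (Set.Iic t).indicator (fun r => ENNReal.ofReal
          (r * ∫ θ in (-π)..π, f (r * cos θ, r * sin θ))) r := by
    intro r hr
    rw [Set.mem_Ioi] at hr
    have hnorm : ∀ θ : ℝ, (r * cos θ) ^ 2 + (r * sin θ) ^ 2 = r ^ 2 := fun θ => by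
      linear_combination r ^ 2 * sin_sq_add_cos_sq θ
    by_cases hrt : r ≤ t
    · rw [Set.indicator_of_mem (Set.mem_Iic.2 hrt), ENNReal.ofReal_mul hr.le,
        intervalIntegral.integral_of_le hπ, integral_Ioc_eq_integral_Ioo,
        ofReal_integral_eq_lintegral_ofReal, ← lintegral_const_mul]
      · refine lintegral_congr fun θ => ?_
        rw [Set.indicator_of_mem]
        · rfl
        · simp only [Set.mem_ofPred_eq, polarCoord_symm_apply, hnorm]
          gcongr
      · fun_prop
      · exact (Continuous.integrableOn_Icc (by fun_prop)).mono_set Set.Ioo_subset_Icc_self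
      · exact Filter.Eventually.of_forall fun θ => hf0 _
    · rw [Set.indicator_of_notMem (by simpa using hrt)]
      rw [← lintegral_zero (μ := volume.restrict (Set.Ioo (-π) π))]
      refine lintegral_congr fun θ => ?_
      rw [Set.indicator_of_notMem, smul_zero]
      simp only [Set.mem_ofPred_eq, polarCoord_symm_apply, hnorm]
      exact fun h => hrt (le_of_sq_le_sq h ht)
  have hmeas : Measurable fun p : ℝ × ℝ => ENNReal.ofReal p.1 •
        ({v : ℝ × ℝ | v.1 ^ 2 + v.2 ^ 2 ≤ t ^ 2}.indicator (fun v => ENNReal.ofReal (f v))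
          (polarCoord.symm p)) := by
    refine Measurable.mul (by fun_prop) ?_
    have hsymm : Measurable fun p : ℝ × ℝ => polarCoord.symm p :=
      Continuous.measurable (by simp only [polarCoord_symm_apply]; fun_prop)
    exact (Measurable.indicator (by fun_prop) hms).comp hsymm
  rw [htarget, Measure.volume_eq_prod, ← Measure.prod_restrict,
    lintegral_prod _ hmeas.aemeasurable, setLIntegral_congr_fun measurableSet_Ioi hinner,
    lintegral_indicator measurableSet_Iic, Measure.restrict_restrict measurableSet_Iic,
    Set.inter_comm, Set.Ioi_inter_Iic, ← ofReal_integral_eq_lintegral_ofReal,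
    ← intervalIntegral.integral_of_le ht]
  · refine (Continuous.integrableOn_Icc ?_).mono_set Set.Ioc_subset_Icc_self
    refine continuous_id.mul
      (intervalIntegral.continuous_parametric_intervalIntegral_of_continuous' ?_ _ _)
    unfold Function.uncurry
    fun_prop
  · refine (ae_restrict_iff' measurableSet_Ioc).2 (Filter.Eventually.of_forall fun r hr => ?_)
    exact mul_nonneg hr.1.le (intervalIntegral.integral_nonneg hπ fun θ _ => hf0 _)

theorem volume_pairs_right_triangle {a b : ℝ} (ha : 0 < a) (hb : 0 < b) {t : ℝ} (ht : 0 ≤ t) :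
    volume {z : (ℝ × ℝ) × (ℝ × ℝ) |
        (0 ≤ z.1.1 ∧ 0 ≤ z.1.2 ∧ b * z.1.1 + a * z.1.2 ≤ a * b) ∧
        (0 ≤ z.2.1 ∧ 0 ≤ z.2.2 ∧ b * z.2.1 + a * z.2.2 ≤ a * b) ∧
        (z.1.1 - z.2.1) ^ 2 + (z.1.2 - z.2.2) ^ 2 ≤ t ^ 2}
      = ENNReal.ofReal (∫ r in (0 : ℝ)..t, r * ∫ θ in (-π)..π,
          a * b / 2 * (max 0 (1 - hexGauge a b (r * cos θ) (r * sin θ))) ^ 2) := by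
  have hcont : Continuous fun v : ℝ × ℝ =>
      a * b / 2 * (max 0 (1 - hexGauge a b v.1 v.2)) ^ 2 := by
    have := continuous_hexGauge a b (continuous_fst (X := ℝ) (Y := ℝ)) continuous_snd
    fun_prop
  rw [← lintegral_disk_eq_integral_polar hcont (fun v => by positivity) ht]
  have hmS : MeasurableSet {z : (ℝ × ℝ) × (ℝ × ℝ) |
        (0 ≤ z.1.1 ∧ 0 ≤ z.1.2 ∧ b * z.1.1 + a * z.1.2 ≤ a * b) ∧
        (0 ≤ z.2.1 ∧ 0 ≤ z.2.2 ∧ b * z.2.1 + a * z.2.2 ≤ a * b) ∧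
        (z.1.1 - z.2.1) ^ 2 + (z.1.2 - z.2.2) ^ 2 ≤ t ^ 2} := by
    measurability
  have hms : MeasurableSet {v : ℝ × ℝ | v.1 ^ 2 + v.2 ^ 2 ≤ t ^ 2} :=
    (isClosed_le (by fun_prop) (by fun_prop)).measurableSet
  have hshear := measurePreserving_prod_add (volume : Measure (ℝ × ℝ)) (volume : Measure (ℝ × ℝ))
  rw [Measure.volume_eq_prod (α := ℝ × ℝ) (β := ℝ × ℝ),
    ← hshear.measure_preimage hmS.nullMeasurableSet,
    Measure.prod_apply_symm (hshear.measurable hmS), ← lintegral_indicator hms]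
  refine lintegral_congr fun v => ?_
  by_cases hv : v ∈ {v : ℝ × ℝ | v.1 ^ 2 + v.2 ^ 2 ≤ t ^ 2}
  · rw [Set.indicator_of_mem hv, ← volume_right_triangle_inter_translate ha hb]
    congr 1
    ext P
    simp only [Set.mem_ofPred_eq] at hv
    simp [hv]
  · rw [Set.indicator_of_notMem hv]
    refine measure_mono_null (t := ∅) ?_ measure_empty
    rintro P ⟨_, _, h⟩
    refine hv ?_
    simpa using h

theorem volume_pairs_euclidean {a b : ℝ} (t : ℝ) (ht : 0 ≤ t) :
    volume {PQ : EuclideanSpace ℝ (Fin 2) × EuclideanSpace ℝ (Fin 2) |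
          (0 ≤ PQ.1 0 ∧ 0 ≤ PQ.1 1 ∧ b * PQ.1 0 + a * PQ.1 1 ≤ a * b) ∧
          (0 ≤ PQ.2 0 ∧ 0 ≤ PQ.2 1 ∧ b * PQ.2 0 + a * PQ.2 1 ≤ a * b) ∧ ‖PQ.1 - PQ.2‖ ≤ t}
      = volume {z : (ℝ × ℝ) × (ℝ × ℝ) |
        (0 ≤ z.1.1 ∧ 0 ≤ z.1.2 ∧ b * z.1.1 + a * z.1.2 ≤ a * b) ∧
        (0 ≤ z.2.1 ∧ 0 ≤ z.2.2 ∧ b * z.2.1 + a * z.2.2 ≤ a * b) ∧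
        (z.1.1 - z.2.1) ^ 2 + (z.1.2 - z.2.2) ^ 2 ≤ t ^ 2} := by
  have hmS : MeasurableSet {z : (ℝ × ℝ) × (ℝ × ℝ) |
        (0 ≤ z.1.1 ∧ 0 ≤ z.1.2 ∧ b * z.1.1 + a * z.1.2 ≤ a * b) ∧
        (0 ≤ z.2.1 ∧ 0 ≤ z.2.2 ∧ b * z.2.1 + a * z.2.2 ≤ a * b) ∧
        (z.1.1 - z.2.1) ^ 2 + (z.1.2 - z.2.2) ^ 2 ≤ t ^ 2} := by
    measurability
  have hφ := (volume_preserving_finTwoArrow ℝ).comp (PiLp.volume_preserving_ofLp (Fin 2))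
  have hφφ := hφ.prod hφ
  rw [Measure.volume_eq_prod (α := ℝ × ℝ) (β := ℝ × ℝ),
    ← hφφ.measure_preimage hmS.nullMeasurableSet, Measure.volume_eq_prod]
  congr 1
  ext ⟨P, Q⟩
  simp only [Set.mem_ofPred_eq, Set.mem_preimage, EuclideanSpace.norm_eq, Fin.sum_univ_two,
    sqrt_le_left ht, Real.norm_eq_abs, sq_abs]
  rfl

theorem hexGauge_mul {r : ℝ} (hr : 0 ≤ r) (a b p q : ℝ) :
    hexGauge a b (r * p) (r * q) = r * hexGauge a b p q := by
  simp only [hexGauge, mul_add, mul_max_of_nonneg _ _ hr, mul_zero, mul_div_assoc, mul_neg]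

theorem density_eq_capIntegral_sum
    (a b c α u A h : ℝ) (hc : 0 < c) (hα0 : 0 < α) (hα1 : α < π / 2)
    (ha : a = c * sin α) (hb : b = c * cos α) (hab : a ≤ b)
    (hu : u = a + b + c)
    (hA : A = a * b / 2)
    (hh : h = a * b / c)
    (Θ₁ Θ₂ Θ₃ Θ₄ Θ₅ Θ₆ : ℝ)
    (hΘ₁ : Θ₁ = (a / b) * (2 * α + π) + (2 * b / a) * (π - α) + 6)
    (hΘ₂ : Θ₂ = (a / b) * (2 * α - π) - (2 * b / a) * α + 6)
    (hΘ₃ : Θ₃ = a / b + b / a)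
    (hΘ₄ : Θ₄ = 1 - (b / a) * α)
    (hΘ₅ : Θ₅ = a + b)
    (hΘ₆ : Θ₆ = (a / b) * (2 * α - π) - (2 * b / a) * α + 2)
    (L₁ L₂ : ℝ → ℝ → ℝ)
    (hL₁ : ∀ t r, L₁ t r = (1 / 2) * (r * Real.sqrt (t ^ 2 - r ^ 2)
      + t ^ 2 * Real.arcsin (r / t)))
    (hL₂ : ∀ t r, L₂ t r = Real.sqrt (t ^ 2 - r ^ 2) + r * Real.arcsin (r / t))
    (H₁ H₂ H₃ H₄ : ℝ → ℝ)
    (hH₁ : ∀ t, H₁ t = Θ₁ * t ^ 2 / 8)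
    (hH₂ : ∀ t, H₂ t = Θ₂ * t ^ 2 / 8 + Θ₃ * L₁ t h + c * L₂ t h)
    (hH₃ : ∀ t, H₃ t = a * t + Θ₄ * t ^ 2 / 2 + (Θ₃ / 2) * L₁ t h + (c / 2) * L₂ t h
      + (b / (2 * a)) * L₁ t a + (b / 2) * L₂ t a)
    (hH₄ : ∀ t, H₄ t = Θ₅ * t + Θ₆ * t ^ 2 / 8 + (b / (2 * a)) * L₁ t a + (b / 2) * L₂ t a
      + (a / (2 * b)) * L₁ t b + (a / 2) * L₂ t b)
    (J : ℝ → ℝ)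
    (hJ₁ : ∀ t, 0 ≤ t → t < h → J t = H₁ t - H₁ 0)
    (hJ₂ : ∀ t, h ≤ t → t < a → J t = (H₁ h - H₁ 0) + (H₂ t - H₂ h))
    (hJ₃ : ∀ t, a ≤ t → t < b → J t = (H₁ h - H₁ 0) + (H₂ a - H₂ h) + (H₃ t - H₃ a))
    (hJ₄ : ∀ t, b ≤ t → t ≤ c → J t = (H₁ h - H₁ 0) + (H₂ a - H₂ h) + (H₃ b - H₃ a)
      + (H₄ t - H₄ b)) (r : ℝ) (hr0 : 0 ≤ r) (hrc : r ≤ c) :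
    π + (J r - u * r) / A = capIntegral (r / h) α + capIntegral (r / h) (π / 2 - α)
      + capIntegral (r / a) (π / 2 - α) + capIntegral (r / b) α := by
  have hS : 0 < sin α := sin_pos_of_pos_of_lt_pi hα0 (by linarith)
  have hC : 0 < cos α := cos_pos_of_mem_Ioo ⟨by linarith, hα1⟩
  have hSC : sin α ^ 2 + cos α ^ 2 = 1 := sin_sq_add_cos_sq α
  have hS1 : sin α < 1 := by nlinarith
  have hC1 : cos α < 1 := by nlinarith
  have hα' : arcsin (sin α) = α := arcsin_sin (by linarith) (by linarith)
  have hα'' : arcsin (cos α) = π / 2 - α := by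
    rw [← sin_pi_div_two_sub]
    exact arcsin_sin (by linarith) (by linarith)
  have hh' : h = c * sin α * cos α := by
    rw [hh, ha, hb]; field_simp
  have ha0 : 0 < a := by rw [ha]; positivity
  have hb0 : 0 < b := by rw [hb]; positivity
  have hh0 : 0 < h := by rw [hh']; positivity
  have hha : h < a := by
    rw [hh', ha]; exact mul_lt_of_lt_one_right (by positivity) hC1
  have hha_div : h / a = cos α := by rw [hh', ha]; field_simp
  have hhb_div : h / b = sin α := by rw [hh', hb]; field_simp
  have hsqa : √(a ^ 2 - h ^ 2) = c * sin α ^ 2 := by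
    rw [show a ^ 2 - h ^ 2 = (c * sin α ^ 2) ^ 2 by
      rw [ha, hh']; linear_combination - c ^ 2 * sin α ^ 2 * hSC]
    exact sqrt_sq (by positivity)
  have hsqb : √(b ^ 2 - h ^ 2) = c * cos α ^ 2 := by
    rw [show b ^ 2 - h ^ 2 = (c * cos α ^ 2) ^ 2 by
      rw [hb, hh']; linear_combination - c ^ 2 * cos α ^ 2 * hSC]
    exact sqrt_sq (by positivity)
  have hac_div : a / c = sin α := by rw [ha]; field_simp
  have hbc_div : b / c = cos α := by rw [hb]; field_simp
  have har1 : arccos (h / a) = α := by rw [hha_div]; exact arccos_cos hα0.le (by linarith)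
  have har2 : arccos (h / b) = π / 2 - α := by
    rw [hhb_div, arccos_eq_pi_div_two_sub_arcsin, hα']
  have har3 : arccos (a / c) = π / 2 - α := by
    rw [hac_div, arccos_eq_pi_div_two_sub_arcsin, hα']
  have har4 : arccos (b / c) = α := by rw [hbc_div]; exact arccos_cos hα0.le (by linarith)
  have hmono : ∀ d x y : ℝ, 0 < d → 0 < x → x ≤ y → arccos (d / x) ≤ arccos (d / y) :=
    fun d x y hd hx hxy => arccos_le_arccos (by gcongr)
  rcases lt_or_ge r h with h1 | h1
  · rw [capIntegral_of_le_one _ (by positivity) ((div_le_one hh0).2 h1.le),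
      capIntegral_of_le_one _ (by positivity) ((div_le_one hh0).2 h1.le),
      capIntegral_of_le_one _ (by positivity) ((div_le_one ha0).2 (h1.trans hha).le),
      capIntegral_of_le_one _ (by positivity) ((div_le_one hb0).2 (by linarith)),
      hJ₁ r hr0 h1, hH₁, hH₁, hΘ₁, hu, hA, hh', ha, hb, sin_pi_div_two_sub, cos_pi_div_two_sub]
    generalize sin α = S at *
    generalize cos α = C at *
    field_simp
    clear * - hSC
    grind
  have hr : 0 < r := hh0.trans_le h1
  rcases lt_or_ge r a with h2 | h2
  · rw [capIntegral_of_arccos_le hh0 h1 (by linarith) (by rw [← har1]; exact hmono _ _ _ hh0 hr h2.le),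
      capIntegral_of_arccos_le hh0 h1 (by linarith) (by rw [← har2]; exact hmono _ _ _ hh0 hr (by linarith)),
      capIntegral_of_le_one _ (by positivity) ((div_le_one ha0).2 h2.le),
      capIntegral_of_le_one _ (by positivity) ((div_le_one hb0).2 (by linarith)),
      hJ₂ r h1 h2]
    simp only [hH₁, hH₂, hL₁, hL₂, hΘ₁, hΘ₂, hΘ₃, hu, hA, sin_pi_div_two_sub, cos_pi_div_two_sub,
      sub_self, sqrt_zero, div_self hh0.ne', arcsin_one]
    generalize arcsin (h / r) = X at *
    generalize √(r ^ 2 - h ^ 2) = Y at *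
    rw [hh', ha, hb]
    generalize sin α = S at *
    generalize cos α = C at *
    field_simp
    clear * - hSC
    grind
  rcases lt_or_ge r b with h3 | h3
  · rw [capIntegral_of_le_arccos hh0 h1 (by linarith) (by rw [← har1]; exact hmono _ _ _ hh0 ha0 h2),
      capIntegral_of_arccos_le hh0 h1 (by linarith) (by rw [← har2]; exact hmono _ _ _ hh0 hr h3.le),
      capIntegral_of_arccos_le ha0 h2 (by linarith) (by rw [← har3]; exact hmono _ _ _ ha0 hr hrc),
      capIntegral_of_le_one _ (by positivity) ((div_le_one hb0).2 (by linarith)),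
      hJ₃ r h2 h3]
    simp only [hH₁, hH₂, hH₃, hL₁, hL₂, hΘ₁, hΘ₂, hΘ₃, hΘ₄, hu, hA, sin_pi_div_two_sub,
      cos_pi_div_two_sub, sub_self, sqrt_zero, div_self hh0.ne', div_self ha0.ne', arcsin_one,
      hha_div, hsqa, hα'']
    generalize arcsin (h / r) = X at *
    generalize √(r ^ 2 - h ^ 2) = Y at *
    generalize arcsin (a / r) = Z at *
    generalize √(r ^ 2 - a ^ 2) = W at *
    rw [hh', ha, hb]
    generalize sin α = S at *
    generalize cos α = C at *
    field_simp
    clear * - hSC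
    grind
  · rw [capIntegral_of_le_arccos hh0 h1 (by linarith) (by rw [← har1]; exact hmono _ _ _ hh0 ha0 h2),
      capIntegral_of_le_arccos hh0 h1 (by linarith) (by rw [← har2]; exact hmono _ _ _ hh0 hb0 h3),
      capIntegral_of_arccos_le ha0 h2 (by linarith) (by rw [← har3]; exact hmono _ _ _ ha0 hr hrc),
      capIntegral_of_arccos_le hb0 h3 (by linarith) (by rw [← har4]; exact hmono _ _ _ hb0 hr hrc),
      hJ₄ r h3 hrc]
    simp only [hH₁, hH₂, hH₃, hH₄, hL₁, hL₂, hΘ₁, hΘ₂, hΘ₃, hΘ₄, hΘ₅, hΘ₆, hu, hA,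
      sin_pi_div_two_sub, cos_pi_div_two_sub, sub_self, sqrt_zero, div_self hh0.ne',
      div_self ha0.ne', div_self hb0.ne', arcsin_one, hha_div, hsqa, hα'', hhb_div, hsqb, hα']
    generalize arcsin (a / r) = Z at *
    generalize √(r ^ 2 - a ^ 2) = W at *
    generalize arcsin (b / r) = X at *
    generalize √(r ^ 2 - b ^ 2) = Y at *
    generalize arcsin (a / b) = V at *
    generalize √(b ^ 2 - a ^ 2) = U at *
    rw [hh', ha, hb]
    generalize sin α = S at *
    generalize cos α = C at *
    field_simp
    clear * - hSC
    grind

/-- The density function of the distance between two uniform random points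
in a right-angled triangle with legs `a ≤ b`. -/
theorem distance_density_right_triangle
    (a b c α u A h : ℝ) (ha : 0 < a) (hab : a ≤ b)
    (hc : c = Real.sqrt (a ^ 2 + b ^ 2))
    (hα : α = Real.arctan (a / b))
    (hu : u = a + b + c)
    (hA : A = a * b / 2)
    (hh : h = a * b / c)
    (T : Set (EuclideanSpace ℝ (Fin 2)))
    (hT : T = {P | 0 ≤ P 0 ∧ 0 ≤ P 1 ∧ b * P 0 + a * P 1 ≤ a * b})
    (Θ₁ Θ₂ Θ₃ Θ₄ Θ₅ Θ₆ : ℝ)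
    (hΘ₁ : Θ₁ = (a / b) * (2 * α + π) + (2 * b / a) * (π - α) + 6)
    (hΘ₂ : Θ₂ = (a / b) * (2 * α - π) - (2 * b / a) * α + 6)
    (hΘ₃ : Θ₃ = a / b + b / a)
    (hΘ₄ : Θ₄ = 1 - (b / a) * α)
    (hΘ₅ : Θ₅ = a + b)
    (hΘ₆ : Θ₆ = (a / b) * (2 * α - π) - (2 * b / a) * α + 2)
    (L₁ L₂ : ℝ → ℝ → ℝ)
    (hL₁ : ∀ t r, L₁ t r = (1 / 2) * (r * Real.sqrt (t ^ 2 - r ^ 2)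
      + t ^ 2 * Real.arcsin (r / t)))
    (hL₂ : ∀ t r, L₂ t r = Real.sqrt (t ^ 2 - r ^ 2) + r * Real.arcsin (r / t))
    (H₁ H₂ H₃ H₄ : ℝ → ℝ)
    (hH₁ : ∀ t, H₁ t = Θ₁ * t ^ 2 / 8)
    (hH₂ : ∀ t, H₂ t = Θ₂ * t ^ 2 / 8 + Θ₃ * L₁ t h + c * L₂ t h)
    (hH₃ : ∀ t, H₃ t = a * t + Θ₄ * t ^ 2 / 2 + (Θ₃ / 2) * L₁ t h + (c / 2) * L₂ t h
      + (b / (2 * a)) * L₁ t a + (b / 2) * L₂ t a)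
    (hH₄ : ∀ t, H₄ t = Θ₅ * t + Θ₆ * t ^ 2 / 8 + (b / (2 * a)) * L₁ t a + (b / 2) * L₂ t a
      + (a / (2 * b)) * L₁ t b + (a / 2) * L₂ t b)
    (J : ℝ → ℝ)
    (hJ₁ : ∀ t, 0 ≤ t → t < h → J t = H₁ t - H₁ 0)
    (hJ₂ : ∀ t, h ≤ t → t < a → J t = (H₁ h - H₁ 0) + (H₂ t - H₂ h))
    (hJ₃ : ∀ t, a ≤ t → t < b → J t = (H₁ h - H₁ 0) + (H₂ a - H₂ h) + (H₃ t - H₃ a))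
    (hJ₄ : ∀ t, b ≤ t → t ≤ c → J t = (H₁ h - H₁ 0) + (H₂ a - H₂ h) + (H₃ b - H₃ a)
      + (H₄ t - H₄ b))
    (g : ℝ → ℝ)
    (hg : ∀ τ, g τ = (2 * τ / A) * (π + (J τ - u * τ) / A)) :
    ∀ t : ℝ, 0 ≤ t → t ≤ c →
      volume {PQ : EuclideanSpace ℝ (Fin 2) × EuclideanSpace ℝ (Fin 2) |
          PQ.1 ∈ T ∧ PQ.2 ∈ T ∧ ‖PQ.1 - PQ.2‖ ≤ t}
        = ENNReal.ofReal (A ^ 2 * ∫ τ in (0:ℝ)..t, g τ) := by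
  intro t ht0 htc
  have hb : 0 < b := ha.trans_le hab
  have hc0 : 0 < c := by rw [hc]; positivity
  have hcsq : c ^ 2 = a ^ 2 + b ^ 2 := by rw [hc]; exact sq_sqrt (by positivity)
  have hsqrt : √(1 + (a / b) ^ 2) = c / b := by
    rw [show 1 + (a / b) ^ 2 = (c / b) ^ 2 by
      rw [div_pow, div_pow, hcsq]; field_simp; ring]
    exact sqrt_sq (by positivity)
  have haS : a = c * sin α := by
    rw [hα, sin_arctan, hsqrt]; field_simp
  have hbC : b = c * cos α := by
    rw [hα, cos_arctan, hsqrt]; field_simp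
  have hα0 : 0 < α := by rw [hα]; exact arctan_pos.2 (by positivity)
  have hα1 : α < π / 2 := by rw [hα]; exact arctan_lt_pi_div_two _
  have hh' : h = c * sin α * cos α := by
    rw [hh, mul_div_assoc, haS, hbC]; field_simp
  have hA0 : A ≠ 0 := by rw [hA]; positivity
  have hset : {PQ : EuclideanSpace ℝ (Fin 2) × EuclideanSpace ℝ (Fin 2) |
      PQ.1 ∈ T ∧ PQ.2 ∈ T ∧ ‖PQ.1 - PQ.2‖ ≤ t} = {PQ |
      (0 ≤ PQ.1 0 ∧ 0 ≤ PQ.1 1 ∧ b * PQ.1 0 + a * PQ.1 1 ≤ a * b) ∧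
      (0 ≤ PQ.2 0 ∧ 0 ≤ PQ.2 1 ∧ b * PQ.2 0 + a * PQ.2 1 ≤ a * b) ∧ ‖PQ.1 - PQ.2‖ ≤ t} := by
    rw [hT]; rfl
  rw [hset, volume_pairs_euclidean t ht0, volume_pairs_right_triangle ha hb ht0,
    ← intervalIntegral.integral_const_mul]
  congr 1
  refine intervalIntegral.integral_congr fun r hr => ?_
  rw [Set.uIcc_of_le ht0] at hr
  have hdens := density_eq_capIntegral_sum a b c α u A h hc0 hα0 hα1 haS hbC hab hu hA hh
    Θ₁ Θ₂ Θ₃ Θ₄ Θ₅ Θ₆ hΘ₁ hΘ₂ hΘ₃ hΘ₄ hΘ₅ hΘ₆ L₁ L₂ hL₁ hL₂ H₁ H₂ H₃ H₄ hH₁ hH₂ hH₃ hH₄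
    J hJ₁ hJ₂ hJ₃ hJ₄ r hr.1 (hr.2.trans htc)
  have hpolar := integral_hexGauge_polar r hc0 hα0 hα1
  rw [← hh', ← haS, ← hbC, ← hdens] at hpolar
  simp only [hexGauge_mul hr.1, intervalIntegral.integral_const_mul]
  rw [hpolar, hg, ← hA]
  generalize π + (J r - u * r) / A = G
  field_simp
end

section
/- For φ ∈ [0,π], the width of T in the direction perpendicular to the angle φ, i.e. w(φ) = sup{−x·sin φ + y·cos φ : (x,y) ∈ T} − inf{−x·sin φ + y·cos φ : (x,y) ∈ T}, satisfies: w(φ) = a·cos(φ−α)/sin α for 0 ≤ φ < π/2; w(φ) = a·sin φ for π/2 ≤ φ < π/2 + α; and w(φ) = −a·cos φ/tan α for π/2 + α ≤ φ ≤ π. -/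
open Real MeasureTheory

/-- A linear form on the triangle with vertices `(0, 0)`, `(a, 0)`, `(0, b)` is bounded above by any
common upper bound for its values at the vertices. -/
lemma linear_form_le_of_vertices_le {a b c d M x y : ℝ} (ha : 0 < a) (hb : 0 < b)
    (hM : 0 ≤ M) (hc : c * a ≤ M) (hd : d * b ≤ M)
    (hx : 0 ≤ x) (hy : 0 ≤ y) (hxy : b * x + a * y ≤ a * b) : c * x + d * y ≤ M := by
  refine le_of_mul_le_mul_left ?_ (mul_pos ha hb)
  calc a * b * (c * x + d * y) = c * a * (b * x) + d * b * (a * y) := by ring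
    _ ≤ M * (b * x) + M * (a * y) := by gcongr
    _ = M * (b * x + a * y) := by ring
    _ ≤ M * (a * b) := by gcongr
    _ = a * b * M := by ring

/-- The maximum of a linear form on a right-angled triangle is attained at a vertex. -/
lemma isGreatest_linear_form_triangle {a b : ℝ} (ha : 0 < a) (hb : 0 < b) (c d : ℝ) :
    IsGreatest ((fun P : ℝ × ℝ => c * P.1 + d * P.2) ''
      {P : ℝ × ℝ | 0 ≤ P.1 ∧ 0 ≤ P.2 ∧ b * P.1 + a * P.2 ≤ a * b})
      (max 0 (max (c * a) (d * b))) := by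
  constructor
  · rcases max_choice 0 (max (c * a) (d * b)) with h | h
    · rw [h]
      exact ⟨(0, 0), by simp [(mul_pos ha hb).le], by simp⟩
    · rw [h]
      rcases max_choice (c * a) (d * b) with h' | h'
      · rw [h']
        exact ⟨(a, 0), by simp [ha.le, mul_comm], by simp⟩
      · rw [h']
        exact ⟨(0, b), by simp [hb.le], by simp⟩
  · rintro _ ⟨P, ⟨hx, hy, hxy⟩, rfl⟩
    exact linear_form_le_of_vertices_le ha hb (le_max_left _ _)
      ((le_max_left _ _).trans (le_max_right _ _)) ((le_max_right _ _).trans (le_max_right _ _))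
      hx hy hxy

/-- The minimum of a linear form on a right-angled triangle is attained at a vertex. -/
lemma isLeast_linear_form_triangle {a b : ℝ} (ha : 0 < a) (hb : 0 < b) (c d : ℝ) :
    IsLeast ((fun P : ℝ × ℝ => c * P.1 + d * P.2) ''
      {P : ℝ × ℝ | 0 ≤ P.1 ∧ 0 ≤ P.2 ∧ b * P.1 + a * P.2 ≤ a * b})
      (min 0 (min (c * a) (d * b))) := by
  constructor
  · rcases min_choice 0 (min (c * a) (d * b)) with h | h
    · rw [h]
      exact ⟨(0, 0), by simp [(mul_pos ha hb).le], by simp⟩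
    · rw [h]
      rcases min_choice (c * a) (d * b) with h' | h'
      · rw [h']
        exact ⟨(a, 0), by simp [ha.le, mul_comm], by simp⟩
      · rw [h']
        exact ⟨(0, b), by simp [hb.le], by simp⟩
  · rintro _ ⟨P, ⟨hx, hy, hxy⟩, rfl⟩
    have h0 := min_le_left 0 (min (c * a) (d * b))
    have hc := (min_le_right 0 (min (c * a) (d * b))).trans (min_le_left _ _)
    have hd := (min_le_right 0 (min (c * a) (d * b))).trans (min_le_right _ _)
    have h := linear_form_le_of_vertices_le (c := -c) (d := -d) ha hb
      (neg_nonneg.2 h0) (by linarith) (by linarith) hx hy hxy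
    simp only
    linarith

/-- The width of the right-angled triangle `T` in the direction perpendicular
to the angle `φ`. -/
theorem width_right_triangle
    (a b α : ℝ) (ha : 0 < a) (hab : a ≤ b)
    (hα : α = Real.arctan (a / b))
    (T : Set (ℝ × ℝ))
    (hT : T = {P : ℝ × ℝ | 0 ≤ P.1 ∧ 0 ≤ P.2 ∧ b * P.1 + a * P.2 ≤ a * b})
    (w : ℝ → ℝ)
    (hw : ∀ φ, w φ = sSup ((fun P : ℝ × ℝ => -P.1 * Real.sin φ + P.2 * Real.cos φ) '' T)
      - sInf ((fun P : ℝ × ℝ => -P.1 * Real.sin φ + P.2 * Real.cos φ) '' T)) :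
    ∀ φ : ℝ,
      (0 ≤ φ → φ < π / 2 → w φ = a * Real.cos (φ - α) / Real.sin α) ∧
      (π / 2 ≤ φ → φ < π / 2 + α → w φ = a * Real.sin φ) ∧
      (π / 2 + α ≤ φ → φ ≤ π → w φ = -(a * Real.cos φ) / Real.tan α) := by
  have hb : 0 < b := ha.trans_le hab
  have hα0 : 0 < α := hα ▸ Real.arctan_pos.2 (div_pos ha hb)
  have hα1 : α < π / 2 := hα ▸ Real.arctan_lt_pi_div_two _
  have hsin : 0 < Real.sin α := Real.sin_pos_of_pos_of_lt_pi hα0 (by linarith)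
  have hcos : 0 < Real.cos α := Real.cos_pos_of_mem_Ioo ⟨by linarith, hα1⟩
  have htan : Real.tan α = a / b := by rw [hα, Real.tan_arctan]
  have hcross : a * Real.cos α = b * Real.sin α := by
    rw [Real.tan_eq_sin_div_cos, div_eq_div_iff hcos.ne' hb.ne'] at htan
    linarith
  intro φ
  have hsum : a * Real.cos (φ - α) / Real.sin α = a * Real.sin φ + b * Real.cos φ := by
    rw [div_eq_iff hsin.ne', Real.cos_sub]
    linear_combination Real.cos φ * hcross
  have hwidth : w φ = max 0 (max (-Real.sin φ * a) (Real.cos φ * b))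
      - min 0 (min (-Real.sin φ * a) (Real.cos φ * b)) := by
    have hform : (fun P : ℝ × ℝ => -P.1 * Real.sin φ + P.2 * Real.cos φ)
        = fun P => -Real.sin φ * P.1 + Real.cos φ * P.2 := by
      funext P
      ring
    rw [hw, hT, hform, (isGreatest_linear_form_triangle ha hb _ _).csSup_eq,
      (isLeast_linear_form_triangle ha hb _ _).csInf_eq]
  refine ⟨fun h1 h2 => ?_, fun h1 h2 => ?_, fun h1 h2 => ?_⟩
  · have hs : 0 ≤ Real.sin φ * a :=
      mul_nonneg (Real.sin_nonneg_of_nonneg_of_le_pi h1 (by linarith)) ha.le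
    have hc : 0 ≤ Real.cos φ * b :=
      mul_nonneg (Real.cos_nonneg_of_mem_Icc ⟨by linarith, h2.le⟩) hb.le
    rw [hwidth, hsum, max_eq_right (by linarith : -Real.sin φ * a ≤ Real.cos φ * b),
      min_eq_left (by linarith : -Real.sin φ * a ≤ Real.cos φ * b),
      max_eq_right hc, min_eq_right (by linarith)]
    ring
  · have hs : 0 ≤ Real.sin φ * a :=
      mul_nonneg (Real.sin_nonneg_of_nonneg_of_le_pi (by linarith) (by linarith)) ha.le
    have hc : Real.cos φ * b ≤ 0 := mul_nonpos_of_nonpos_of_nonneg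
      (Real.cos_nonpos_of_pi_div_two_le_of_le h1 (by linarith)) hb.le
    have hnn : 0 ≤ a * Real.cos (φ - α) / Real.sin α := div_nonneg
      (mul_nonneg ha.le (Real.cos_nonneg_of_mem_Icc ⟨by linarith, by linarith⟩)) hsin.le
    rw [hsum] at hnn
    rw [hwidth, max_eq_left (max_le (by linarith) hc),
      min_eq_left (by linarith : -Real.sin φ * a ≤ Real.cos φ * b), min_eq_right (by linarith)]
    ring
  · have hs : 0 ≤ Real.sin φ * a :=
      mul_nonneg (Real.sin_nonneg_of_nonneg_of_le_pi (by linarith) h2) ha.le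
    have hc : Real.cos φ * b ≤ 0 := mul_nonpos_of_nonpos_of_nonneg
      (Real.cos_nonpos_of_pi_div_two_le_of_le (by linarith) (by linarith)) hb.le
    have hnp : a * Real.cos (φ - α) / Real.sin α ≤ 0 := div_nonpos_of_nonpos_of_nonneg
      (mul_nonpos_of_nonneg_of_nonpos ha.le
        (Real.cos_nonpos_of_pi_div_two_le_of_le (by linarith) (by linarith))) hsin.le
    rw [hsum] at hnp
    rw [hwidth, htan, max_eq_left (max_le (by linarith) hc),
      min_eq_right (by linarith : Real.cos φ * b ≤ -Real.sin φ * a), min_eq_right hc]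
    field_simp
    ring
end

section
/- For every real s, ∫₀^{π/2} (b₁(s,φ) + b₂(s,φ)) dφ + ∫_{π/2}^{π/2+α} (b₁(s,φ) + b₃(s,φ)) dφ + ∫_{π/2+α}^{π} (b₂(s,φ) + b₃(s,φ)) dφ = Θ₁·s/4, where Θ₁ = (a/b)(2α+π) + (2b/a)(π−α) + 6. -/
open Real MeasureTheory

/-- Integral of a shifted sine of the double angle plus a constant. -/
lemma integral_sin_two_mul_sub_add_const (k α c u v : ℝ) :
    ∫ φ in u..v, k * (sin (2 * φ - α) + c) =
      k * ((cos (2 * u - α) - cos (2 * v - α)) / 2 + (v - u) * c) := by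
  rw [intervalIntegral.integral_const_mul, intervalIntegral.integral_add
    (Continuous.intervalIntegrable (by fun_prop) _ _) (by simp),
    intervalIntegral.integral_comp_mul_sub sin two_ne_zero, integral_sin]
  simp only [intervalIntegral.integral_const, smul_eq_mul]
  ring

/-- Integral of a shifted cosine of the double angle plus a constant. -/
lemma integral_cos_two_mul_sub_add_const (k α c u v : ℝ) :
    ∫ φ in u..v, k * (cos (2 * φ - α) + c) =
      k * ((sin (2 * v - α) - sin (2 * u - α)) / 2 + (v - u) * c) := by
  rw [intervalIntegral.integral_const_mul, intervalIntegral.integral_add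
    (Continuous.intervalIntegrable (by fun_prop) _ _) (by simp),
    intervalIntegral.integral_comp_mul_sub cos two_ne_zero, integral_cos]
  simp only [intervalIntegral.integral_const, smul_eq_mul]
  ring

/-- Computation of `H₁(s)`: the integral of the strip breadths over the angle ranges. -/
theorem strip_integral_H1
    (a b α : ℝ) (ha : 0 < a) (hab : a ≤ b)
    (hα : α = Real.arctan (a / b))
    (b₁ b₂ b₃ : ℝ → ℝ → ℝ)
    (hb₁ : ∀ s φ, b₁ s φ = (s / 2) * (Real.sin (2 * φ - α) + Real.sin α) / Real.cos α)
    (hb₂ : ∀ s φ, b₂ s φ = (s / 2) * (Real.cos (2 * φ - α) + Real.cos α) / Real.sin α)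
    (hb₃ : ∀ s φ, b₃ s φ = -(s / 2) * Real.sin (2 * φ)) :
    ∀ s : ℝ,
      (∫ φ in (0:ℝ)..(π / 2), (b₁ s φ + b₂ s φ))
        + (∫ φ in (π / 2)..(π / 2 + α), (b₁ s φ + b₃ s φ))
        + (∫ φ in (π / 2 + α)..π, (b₂ s φ + b₃ s φ))
      = ((a / b) * (2 * α + π) + (2 * b / a) * (π - α) + 6) * s / 4 := by
  intro s
  have hb : 0 < b := ha.trans_le hab
  have hcos : 0 < cos α := hα ▸ cos_arctan_pos _
  have hsin_eq : sin α = a / b * cos α := by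
    rw [← tan_mul_cos hcos.ne', hα, tan_arctan]
  have h₁ : b₁ s = fun φ => s / 2 / cos α * (sin (2 * φ - α) + sin α) := by
    ext φ
    rw [hb₁]
    ring
  have h₂ : b₂ s = fun φ => s / 2 / sin α * (cos (2 * φ - α) + cos α) := by
    ext φ
    rw [hb₂]
    ring
  have h₃ : b₃ s = fun φ => -(s / 2) * (sin (2 * φ - 0) + 0) := by
    ext φ
    rw [hb₃, sub_zero, add_zero]
  have hi₁ (u v : ℝ) : IntervalIntegrable (b₁ s) volume u v := by
    rw [h₁]
    exact Continuous.intervalIntegrable (by fun_prop) _ _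
  have hi₂ (u v : ℝ) : IntervalIntegrable (b₂ s) volume u v := by
    rw [h₂]
    exact Continuous.intervalIntegrable (by fun_prop) _ _
  have hi₃ (u v : ℝ) : IntervalIntegrable (b₃ s) volume u v := by
    rw [h₃]
    exact Continuous.intervalIntegrable (by fun_prop) _ _
  rw [intervalIntegral.integral_add (hi₁ _ _) (hi₂ _ _),
    intervalIntegral.integral_add (hi₁ _ _) (hi₃ _ _),
    intervalIntegral.integral_add (hi₂ _ _) (hi₃ _ _), h₁, h₂, h₃]
  simp only [integral_sin_two_mul_sub_add_const, integral_cos_two_mul_sub_add_const]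
  rw [show 2 * (π / 2) - α = π - α by ring, show 2 * (π / 2 + α) - α = α + π by ring,
    show 2 * (0 : ℝ) - α = -α by ring, show 2 * (π / 2) - 0 = π by ring,
    show 2 * π - 0 = 2 * π by ring]
  simp only [cos_pi_sub, sin_pi_sub, cos_add_pi, sin_add_pi, cos_neg, sin_neg,
    sin_two_pi_sub, cos_two_pi, cos_pi]
  rw [hsin_eq]
  field_simp
  ring
end

section
/- For every s with h ≤ s ≤ a, setting φ₁ = α − arccos((a/s)·cos α) and φ₂ = α + arccos((a/s)·cos α), one has ∫₀^{φ₁} (b₁(s,φ) + b₂(s,φ)) dφ + ∫_{φ₁}^{φ₂} w₁(φ) dφ + ∫_{φ₂}^{π/2} (b₁(s,φ) + b₂(s,φ)) dφ + ∫_{π/2}^{π/2+α} (b₁(s,φ) + b₃(s,φ)) dφ + ∫_{π/2+α}^{π} (b₂(s,φ) + b₃(s,φ)) dφ = Θ₂·s/4 + Θ₃·s·arcsin(h/s) + c·√(1 − (h/s)²), where Θ₂ = (a/b)(2α−π) − (2b/a)α + 6 and Θ₃ = a/b + b/a. -/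
open Real MeasureTheory

theorem integral_two_mul_sin_sub_add_const (k α d u v : ℝ) :
    ∫ φ in u..v, k * (sin (2 * φ - α) + sin α) / d
      = k / d * (-cos (2 * v - α) / 2 + v * sin α)
        - k / d * (-cos (2 * u - α) / 2 + u * sin α) := by
  refine intervalIntegral.integral_eq_sub_of_hasDerivAt
    (f := fun x => k / d * (-cos (2 * x - α) / 2 + x * sin α)) (fun x _ => ?_)
    (Continuous.intervalIntegrable (by fun_prop) _ _)
  have h := (((((hasDerivAt_id x).const_mul 2).sub_const α).cos.neg.div_const 2).add
    ((hasDerivAt_id x).mul_const (sin α))).const_mul (k / d)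
  refine h.congr_deriv ?_
  simp only [id]
  ring

theorem integral_two_mul_cos_sub_add_const (k α d u v : ℝ) :
    ∫ φ in u..v, k * (cos (2 * φ - α) + cos α) / d
      = k / d * (sin (2 * v - α) / 2 + v * cos α)
        - k / d * (sin (2 * u - α) / 2 + u * cos α) := by
  refine intervalIntegral.integral_eq_sub_of_hasDerivAt
    (f := fun x => k / d * (sin (2 * x - α) / 2 + x * cos α)) (fun x _ => ?_)
    (Continuous.intervalIntegrable (by fun_prop) _ _)
  have h := (((((hasDerivAt_id x).const_mul 2).sub_const α).sin.div_const 2).add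
    ((hasDerivAt_id x).mul_const (cos α))).const_mul (k / d)
  refine h.congr_deriv ?_
  simp only [id]
  ring

theorem integral_const_mul_sin_two_mul (k u v : ℝ) :
    ∫ φ in u..v, k * sin (2 * φ) = -k / 2 * cos (2 * v) + k / 2 * cos (2 * u) := by
  rw [intervalIntegral.integral_const_mul,
    intervalIntegral.integral_comp_mul_left (fun x => sin x) two_ne_zero, integral_sin]
  simp only [smul_eq_mul]
  ring

theorem integral_const_mul_cos_sub_div (k α d u v : ℝ) :
    ∫ φ in u..v, k * cos (φ - α) / d = k * (sin (v - α) - sin (u - α)) / d := by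
  rw [intervalIntegral.integral_div, intervalIntegral.integral_const_mul,
    intervalIntegral.integral_comp_sub_right (fun x => cos x), integral_cos]

/-- Computation of `H₂(s)` for `h ≤ s ≤ a`. -/
theorem strip_integral_H2
    (a b c α h : ℝ) (ha : 0 < a) (hab : a ≤ b)
    (hc : c = Real.sqrt (a ^ 2 + b ^ 2))
    (hα : α = Real.arctan (a / b))
    (hh : h = a * b / c)
    (b₁ b₂ b₃ : ℝ → ℝ → ℝ) (w₁ : ℝ → ℝ)
    (hb₁ : ∀ s φ, b₁ s φ = (s / 2) * (Real.sin (2 * φ - α) + Real.sin α) / Real.cos α)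
    (hb₂ : ∀ s φ, b₂ s φ = (s / 2) * (Real.cos (2 * φ - α) + Real.cos α) / Real.sin α)
    (hb₃ : ∀ s φ, b₃ s φ = -(s / 2) * Real.sin (2 * φ))
    (hw₁ : ∀ φ, w₁ φ = a * Real.cos (φ - α) / Real.sin α) :
    ∀ s : ℝ, h ≤ s → s ≤ a →
      ∀ φ₁ φ₂ : ℝ,
        φ₁ = α - Real.arccos ((a / s) * Real.cos α) →
        φ₂ = α + Real.arccos ((a / s) * Real.cos α) →
        (∫ φ in (0:ℝ)..φ₁, (b₁ s φ + b₂ s φ))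
          + (∫ φ in φ₁..φ₂, w₁ φ)
          + (∫ φ in φ₂..(π / 2), (b₁ s φ + b₂ s φ))
          + (∫ φ in (π / 2)..(π / 2 + α), (b₁ s φ + b₃ s φ))
          + (∫ φ in (π / 2 + α)..π, (b₂ s φ + b₃ s φ))
        = ((a / b) * (2 * α - π) - (2 * b / a) * α + 6) * s / 4
          + (a / b + b / a) * (s * Real.arcsin (h / s))
          + c * Real.sqrt (1 - (h / s) ^ 2) := by
  intro s hs hsa φ₁ φ₂ hφ₁ hφ₂
  have hb : 0 < b := ha.trans_le hab
  have hc0 : 0 < c := by rw [hc]; positivity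
  have hc2 : c ^ 2 = a ^ 2 + b ^ 2 := by rw [hc, sq_sqrt (by positivity)]
  have hroot : √(1 + (a / b) ^ 2) = c / b := by
    rw [hc, show 1 + (a / b) ^ 2 = (a ^ 2 + b ^ 2) / b ^ 2 by field_simp; ring,
      sqrt_div (by positivity), sqrt_sq hb.le]
  have hsin : sin α = a / c := by
    rw [hα, sin_arctan, hroot]; field_simp
  have hcos : cos α = b / c := by
    rw [hα, cos_arctan, hroot]; field_simp
  have hh0 : 0 < h := by rw [hh]; positivity
  have hs0 : 0 < s := hh0.trans_le hs
  have harg : a / s * cos α = h / s := by rw [hcos, hh]; field_simp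
  rw [harg] at hφ₁ hφ₂
  have hcosθ : cos (arccos (h / s)) = h / s :=
    cos_arccos (by linarith [div_pos hh0 hs0]) ((div_le_one hs0).2 hs)
  rw [arcsin_eq_pi_div_two_sub_arccos, ← sin_arccos]
  set θ := arccos (h / s)
  simp only [hb₁, hb₂, hb₃, hw₁]
  have i₁ : ∀ u v : ℝ, IntervalIntegrable
      (fun φ => s / 2 * (sin (2 * φ - α) + sin α) / cos α) volume u v :=
    fun u v => Continuous.intervalIntegrable (by fun_prop) u v
  have i₂ : ∀ u v : ℝ, IntervalIntegrable
      (fun φ => s / 2 * (cos (2 * φ - α) + cos α) / sin α) volume u v :=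
    fun u v => Continuous.intervalIntegrable (by fun_prop) u v
  have i₃ : ∀ u v : ℝ, IntervalIntegrable (fun φ => -(s / 2) * sin (2 * φ)) volume u v :=
    fun u v => Continuous.intervalIntegrable (by fun_prop) u v
  simp only [intervalIntegral.integral_add (i₁ _ _) (i₂ _ _),
    intervalIntegral.integral_add (i₁ _ _) (i₃ _ _),
    intervalIntegral.integral_add (i₂ _ _) (i₃ _ _),
    integral_two_mul_sin_sub_add_const, integral_two_mul_cos_sub_add_const,
    integral_const_mul_sin_two_mul, integral_const_mul_cos_sub_div, hφ₁, hφ₂]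
  rw [show 2 * (α - θ) - α = α - 2 * θ by ring, show 2 * (α + θ) - α = α + 2 * θ by ring,
    show α - θ - α = -θ by ring, show α + θ - α = θ by ring,
    show 2 * (0 : ℝ) - α = -α by ring, show 2 * (π / 2) - α = π - α by ring,
    show 2 * (π / 2 + α) - α = α + π by ring, show 2 * (π / 2) = π by ring,
    show 2 * (π / 2 + α) = 2 * α + π by ring]
  simp only [cos_sub α, cos_add α, sin_sub α, sin_add α, sin_neg, cos_neg, cos_pi_sub, sin_pi_sub,
    sin_two_pi_sub, cos_add_pi, cos_two_pi, cos_pi, sin_pi, sin_two_mul θ,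
    hcosθ, hsin, hcos, hh]
  field_simp
  linear_combination (16 * a * b * sin θ) * hc2
end

section
/- For every s with a ≤ s ≤ b, setting φ₂ = α + arccos((a/s)·cos α) and φ₃ = π − arccos(a/s), one has ∫₀^{φ₂} w₁(φ) dφ + ∫_{φ₂}^{π/2} (b₁(s,φ) + b₂(s,φ)) dφ + ∫_{π/2}^{π/2+α} (b₁(s,φ) + b₃(s,φ)) dφ + ∫_{π/2+α}^{φ₃} (b₂(s,φ) + b₃(s,φ)) dφ + ∫_{φ₃}^{π} w₃(φ) dφ = a + Θ₄·s + (Θ₃/2)·s·arcsin(h/s) + (c/2)·√(1 − (h/s)²) + (b/(2a))·s·arcsin(a/s) + (b/2)·√(1 − (a/s)²), where Θ₃ = a/b + b/a and Θ₄ = 1 − (b/a)α. -/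
open Real MeasureTheory

lemma integral_eq_sub_of_deriv_continuous {f F : ℝ → ℝ} (hF : ∀ x, HasDerivAt F (f x) x)
    (hf : Continuous f) (p q : ℝ) : ∫ x in p..q, f x = F q - F p :=
  intervalIntegral.integral_eq_sub_of_hasDerivAt (fun x _ => hF x) (hf.intervalIntegrable p q)

lemma hasDerivAt_sin_two_mul_sub (α x : ℝ) :
    HasDerivAt (fun φ => sin (2 * φ - α)) (cos (2 * x - α) * 2) x := by
  simpa using (((hasDerivAt_id x).const_mul 2).sub_const α).sin

lemma hasDerivAt_cos_two_mul_sub (α x : ℝ) :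
    HasDerivAt (fun φ => cos (2 * φ - α)) (-sin (2 * x - α) * 2) x := by
  simpa using (((hasDerivAt_id x).const_mul 2).sub_const α).cos

lemma hasDerivAt_sin_sub_primitive (k α d x : ℝ) :
    HasDerivAt (fun φ => k * (φ * sin α - cos (2 * φ - α) / 2) / d)
      (k * (sin (2 * x - α) + sin α) / d) x := by
  refine (((((hasDerivAt_id x).mul_const (sin α)).sub
    ((hasDerivAt_cos_two_mul_sub α x).div_const 2)).const_mul k).div_const d).congr_deriv ?_
  ring

lemma hasDerivAt_cos_sub_primitive (k α d x : ℝ) :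
    HasDerivAt (fun φ => k * (φ * cos α + sin (2 * φ - α) / 2) / d)
      (k * (cos (2 * x - α) + cos α) / d) x := by
  refine (((((hasDerivAt_id x).mul_const (cos α)).add
    ((hasDerivAt_sin_two_mul_sub α x).div_const 2)).const_mul k).div_const d).congr_deriv ?_
  ring

lemma hasDerivAt_sin_two_mul_primitive (k x : ℝ) :
    HasDerivAt (fun φ => k * cos (2 * φ) / 2) (-k * sin (2 * x)) x := by
  have h := ((hasDerivAt_cos_two_mul_sub 0 x).const_mul k).div_const 2
  simp only [sub_zero] at h
  refine h.congr_deriv ?_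
  ring

/-- Computation of `H₃(s)` for `a ≤ s ≤ b`. -/
theorem strip_integral_H3
    (a b c α h : ℝ) (ha : 0 < a) (hab : a ≤ b)
    (hc : c = Real.sqrt (a ^ 2 + b ^ 2))
    (hα : α = Real.arctan (a / b))
    (hh : h = a * b / c)
    (b₁ b₂ b₃ : ℝ → ℝ → ℝ) (w₁ w₃ : ℝ → ℝ)
    (hb₁ : ∀ s φ, b₁ s φ = (s / 2) * (Real.sin (2 * φ - α) + Real.sin α) / Real.cos α)
    (hb₂ : ∀ s φ, b₂ s φ = (s / 2) * (Real.cos (2 * φ - α) + Real.cos α) / Real.sin α)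
    (hb₃ : ∀ s φ, b₃ s φ = -(s / 2) * Real.sin (2 * φ))
    (hw₁ : ∀ φ, w₁ φ = a * Real.cos (φ - α) / Real.sin α)
    (hw₃ : ∀ φ, w₃ φ = -(a * Real.cos φ) / Real.tan α) :
    ∀ s : ℝ, a ≤ s → s ≤ b →
      ∀ φ₂ φ₃ : ℝ,
        φ₂ = α + Real.arccos ((a / s) * Real.cos α) →
        φ₃ = π - Real.arccos (a / s) →
        (∫ φ in (0:ℝ)..φ₂, w₁ φ)
          + (∫ φ in φ₂..(π / 2), (b₁ s φ + b₂ s φ))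
          + (∫ φ in (π / 2)..(π / 2 + α), (b₁ s φ + b₃ s φ))
          + (∫ φ in (π / 2 + α)..φ₃, (b₂ s φ + b₃ s φ))
          + (∫ φ in φ₃..π, w₃ φ)
        = a + (1 - (b / a) * α) * s
          + ((a / b + b / a) / 2) * (s * Real.arcsin (h / s))
          + (c / 2) * Real.sqrt (1 - (h / s) ^ 2)
          + (b / (2 * a)) * (s * Real.arcsin (a / s))
          + (b / 2) * Real.sqrt (1 - (a / s) ^ 2) := by
  intro s has hsb φ₂ φ₃ hφ₂ hφ₃
  have hb : 0 < b := ha.trans_le hab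
  have hs : 0 < s := ha.trans_le has
  have hc0 : 0 < c := by rw [hc]; positivity
  have hc2 : c ^ 2 = a ^ 2 + b ^ 2 := by rw [hc, sq_sqrt (by positivity)]
  have hsq : √(1 + (a / b) ^ 2) = c / b := by
    rw [sqrt_eq_iff_mul_self_eq (by positivity) (by positivity)]
    field_simp
    linarith
  have hsin : sin α = a / c := by
    rw [hα, sin_arctan, hsq]
    field_simp
  have hcos : cos α = b / c := by
    rw [hα, cos_arctan, hsq]
    field_simp
  have htan : tan α = a / b := by rw [hα, tan_arctan]
  have hx : a / s * cos α = h / s := by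
    rw [hcos, hh]
    field_simp
  have hy1 : a / s ≤ 1 := (div_le_one hs).2 has
  have hy0 : 0 ≤ a / s := by positivity
  have hx0 : 0 ≤ h / s := by rw [hh]; positivity
  have hx1 : h / s ≤ 1 := by
    rw [← hx]
    exact mul_le_one₀ hy1 (by rw [hcos]; positivity) (cos_le_one α)
  have hsA : sin (arcsin (h / s)) = h / s := sin_arcsin (by linarith) hx1
  have hsB : sin (arcsin (a / s)) = a / s := sin_arcsin (by linarith) hy1
  rw [hx, arccos_eq_pi_div_two_sub_arcsin] at hφ₂
  rw [arccos_eq_pi_div_two_sub_arcsin] at hφ₃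
  rw [← cos_arcsin, ← cos_arcsin]
  set A := arcsin (h / s)
  set B := arcsin (a / s)
  obtain rfl : b₁ = _ := funext₂ hb₁
  obtain rfl : b₂ = _ := funext₂ hb₂
  obtain rfl : b₃ = _ := funext₂ hb₃
  obtain rfl : w₁ = _ := funext hw₁
  obtain rfl : w₃ = _ := funext hw₃
  have int_w₁ := integral_eq_sub_of_deriv_continuous
    (f := fun φ => a * cos (φ - α) / sin α) (F := fun φ => a * sin (φ - α) / sin α)
    (fun x => by simpa using ((((hasDerivAt_id x).sub_const α).sin).const_mul a).div_const (sin α))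
    (by fun_prop) 0 φ₂
  have int_b₁_add_b₂ := integral_eq_sub_of_deriv_continuous
    (fun x => (hasDerivAt_sin_sub_primitive (s / 2) α (cos α) x).add
      (hasDerivAt_cos_sub_primitive (s / 2) α (sin α) x)) (by fun_prop) φ₂ (π / 2)
  have int_b₁_add_b₃ := integral_eq_sub_of_deriv_continuous
    (fun x => (hasDerivAt_sin_sub_primitive (s / 2) α (cos α) x).add
      (hasDerivAt_sin_two_mul_primitive (s / 2) x)) (by fun_prop) (π / 2) (π / 2 + α)
  have int_b₂_add_b₃ := integral_eq_sub_of_deriv_continuous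
    (fun x => (hasDerivAt_cos_sub_primitive (s / 2) α (sin α) x).add
      (hasDerivAt_sin_two_mul_primitive (s / 2) x)) (by fun_prop) (π / 2 + α) φ₃
  have int_w₃ := integral_eq_sub_of_deriv_continuous
    (f := fun φ => -(a * cos φ) / tan α) (F := fun φ => -(a * sin φ) / tan α)
    (fun x => (((hasDerivAt_sin x).const_mul a).neg).div_const (tan α)) (by fun_prop) φ₃ π
  simp only [Pi.add_apply] at int_b₁_add_b₂ int_b₁_add_b₃ int_b₂_add_b₃
  rw [int_w₁, int_b₁_add_b₂, int_b₁_add_b₃, int_b₂_add_b₃, int_w₃]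
  have φ₂_sub : φ₂ - α = π / 2 - A := by rw [hφ₂]; ring
  have two_φ₂_sub : 2 * φ₂ - α = α - 2 * A + π := by rw [hφ₂]; ring
  have two_quarter_add : 2 * (π / 2 + α) = 2 * α + π := by ring
  have two_quarter : 2 * (π / 2) = π := by ring
  have φ₃_eq : φ₃ = B + π / 2 := by rw [hφ₃]; ring
  have two_φ₃ : 2 * (B + π / 2) = 2 * B + π := by ring
  simp only [φ₂_sub, two_φ₂_sub, two_quarter_add, two_quarter, φ₃_eq, two_φ₃]
  simp only [hφ₂, sin_add_pi, cos_add_pi, sin_add_pi_div_two, zero_sub, sin_neg, sin_pi, cos_pi,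
    sin_pi_div_two, cos_pi_div_two, sin_sub, cos_sub, sin_two_mul, cos_two_mul', cos_sq' A,
    cos_sq' B, hsA, hsB, hsin, hcos, htan, hh]
  field_simp
  linear_combination (2 * a * b * c * cos A * s - 2 * a * b * s ^ 2) * hc2
end

section
/- For every s with b ≤ s ≤ c, setting φ₃ = π − arccos(a/s) and φ₄ = π − arcsin((a/s)·cot α), one has ∫₀^{π/2} w₁(φ) dφ + ∫_{π/2}^{φ₄} w₂(φ) dφ + ∫_{φ₄}^{π/2+α} (b₁(s,φ) + b₃(s,φ)) dφ + ∫_{π/2+α}^{φ₃} (b₂(s,φ) + b₃(s,φ)) dφ + ∫_{φ₃}^{π} w₃(φ) dφ = (a+b) + Θ₆·s/4 + (b/(2a))·s·arcsin(a/s) + (b/2)·√(1 − (a/s)²) + (a/(2b))·s·arcsin(b/s) + (a/2)·√(1 − (b/s)²), where Θ₆ = (a/b)(2α−π) − (2b/a)α + 2. -/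
open Real MeasureTheory

/-- The integral of `k * (1 + ε * cos (2 φ))` over an interval. -/
theorem integral_const_mul_one_add_mul_cos_two_mul (k ε x y : ℝ) :
    ∫ φ in x..y, k * (1 + ε * cos (2 * φ)) =
      k * (y - x + ε * (sin y * cos y - sin x * cos x)) := by
  have hderiv : ∀ t : ℝ, HasDerivAt (fun u => k * (u + ε * (sin u * cos u)))
      (k * (1 + ε * cos (2 * t))) t := by
    intro t
    have h := ((hasDerivAt_id t).add
      (((hasDerivAt_sin t).mul (hasDerivAt_cos t)).const_mul ε)).const_mul k
    refine h.congr_deriv ?_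
    rw [cos_two_mul']
    ring
  rw [intervalIntegral.integral_eq_sub_of_hasDerivAt (fun t _ => hderiv t)
    (Continuous.intervalIntegrable (by fun_prop) _ _)]
  ring

/-- Computation of `H₄(s)` for `b ≤ s ≤ c`. -/
theorem strip_integral_H4
    (a b c α : ℝ) (ha : 0 < a) (hab : a ≤ b)
    (hc : c = Real.sqrt (a ^ 2 + b ^ 2))
    (hα : α = Real.arctan (a / b))
    (b₁ b₂ b₃ : ℝ → ℝ → ℝ) (w₁ w₂ w₃ : ℝ → ℝ)
    (hb₁ : ∀ s φ, b₁ s φ = (s / 2) * (Real.sin (2 * φ - α) + Real.sin α) / Real.cos α)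
    (hb₂ : ∀ s φ, b₂ s φ = (s / 2) * (Real.cos (2 * φ - α) + Real.cos α) / Real.sin α)
    (hb₃ : ∀ s φ, b₃ s φ = -(s / 2) * Real.sin (2 * φ))
    (hw₁ : ∀ φ, w₁ φ = a * Real.cos (φ - α) / Real.sin α)
    (hw₂ : ∀ φ, w₂ φ = a * Real.sin φ)
    (hw₃ : ∀ φ, w₃ φ = -(a * Real.cos φ) / Real.tan α) :
    ∀ s : ℝ, b ≤ s → s ≤ c →
      ∀ φ₃ φ₄ : ℝ,
        φ₃ = π - Real.arccos (a / s) →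
        φ₄ = π - Real.arcsin ((a / s) * Real.cot α) →
        (∫ φ in (0:ℝ)..(π / 2), w₁ φ)
          + (∫ φ in (π / 2)..φ₄, w₂ φ)
          + (∫ φ in φ₄..(π / 2 + α), (b₁ s φ + b₃ s φ))
          + (∫ φ in (π / 2 + α)..φ₃, (b₂ s φ + b₃ s φ))
          + (∫ φ in φ₃..π, w₃ φ)
        = (a + b) + ((a / b) * (2 * α - π) - (2 * b / a) * α + 2) * s / 4
          + (b / (2 * a)) * (s * Real.arcsin (a / s))
          + (b / 2) * Real.sqrt (1 - (a / s) ^ 2)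
          + (a / (2 * b)) * (s * Real.arcsin (b / s))
          + (a / 2) * Real.sqrt (1 - (b / s) ^ 2) := by
  intro s hbs _ φ₃ φ₄ hφ₃ hφ₄
  have hb : 0 < b := ha.trans_le hab
  have hs : 0 < s := hb.trans_le hbs
  have hC : 0 < cos α := by rw [hα]; exact cos_arctan_pos _
  have htan : tan α = a / b := by rw [hα, tan_arctan]
  have hS : a * cos α = b * sin α := by
    rw [tan_eq_sin_div_cos] at htan
    field_simp at htan
    linarith
  have hSpos : 0 < sin α := by
    have : 0 < b * sin α := hS ▸ mul_pos ha hC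
    exact pos_of_mul_pos_right this hb.le
  have hcot : cot α = b / a := by
    rw [cot_eq_cos_div_sin]
    field_simp
    linarith
  have hφ₃' : φ₃ = arcsin (a / s) + π / 2 := by rw [hφ₃, arccos]; ring
  have hφ₄' : φ₄ = π - arcsin (b / s) := by
    rw [hφ₄, hcot]
    congr 2
    field_simp
  have hsinA : sin (arcsin (a / s)) = a / s :=
    sin_arcsin (by linarith [div_pos ha hs]) ((div_le_one hs).2 (hab.trans hbs))
  have hsinB : sin (arcsin (b / s)) = b / s :=
    sin_arcsin (by linarith [div_pos hb hs]) ((div_le_one hs).2 hbs)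
  have e₁ : w₁ = fun φ => b * cos φ + a * sin φ := by
    funext φ
    rw [hw₁, cos_sub]
    field_simp
    linear_combination cos φ * hS
  have e₂ : w₂ = fun φ => a * sin φ := funext hw₂
  have e₃ : w₃ = fun φ => -b * cos φ := by
    funext φ
    rw [hw₃, htan]
    field_simp
  have e₁₃ : ∀ φ, b₁ s φ + b₃ s φ = s * a / (2 * b) * (1 + -1 * cos (2 * φ)) := by
    intro φ
    rw [hb₁, hb₃, sin_sub]
    field_simp
    linear_combination (cos (2 * φ) - 1) * hS
  have e₂₃ : ∀ φ, b₂ s φ + b₃ s φ = s * b / (2 * a) * (1 + 1 * cos (2 * φ)) := by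
    intro φ
    rw [hb₂, hb₃, cos_sub]
    field_simp
    linear_combination (cos (2 * φ) + 1) * hS
  have hconst : (a / b + b / a) * (sin α * cos α) = 1 := by
    rw [← htan, ← hcot, tan_eq_sin_div_cos, cot_eq_cos_div_sin]
    field_simp
    exact sin_sq_add_cos_sq α
  simp only [e₁₃, e₂₃, integral_const_mul_one_add_mul_cos_two_mul, e₁, e₂, e₃]
  rw [intervalIntegral.integral_add (Continuous.intervalIntegrable (by fun_prop) _ _)
    (Continuous.intervalIntegrable (by fun_prop) _ _)]
  simp only [intervalIntegral.integral_const_mul, integral_cos, integral_sin]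
  rw [hφ₃', hφ₄', add_comm (π / 2) α]
  simp only [sin_add_pi_div_two, cos_add_pi_div_two, sin_pi_sub, cos_pi_sub, sin_pi_div_two,
    cos_pi_div_two, sin_zero, cos_zero, sin_pi, hsinA, hsinB, cos_arcsin]
  generalize √(1 - (a / s) ^ 2) = p
  generalize √(1 - (b / s) ^ 2) = q
  have hp : s * b / (2 * a) * (p * (a / s)) = b / 2 * p := by field_simp
  have hq : s * a / (2 * b) * (b / s * q) = a / 2 * q := by field_simp
  linear_combination (s / 2) * hconst - hp - hq
end
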